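/- arXiv:1304.6576 — 2 statements merged into one kernel-verified Lean document; each statement's English description precedes it below -/
import Mathlib

section
/- There exists a transcendental entire function f of finite order with bounded singular set S(f), together with a compact set K contained in the unbounded connected component of ℂ∖S(f), such that ∫_{f⁻¹(K)∖𝔻} dx dy/|z|² = ∞. In other words, the area property near infinity fails for some finite-order function in the Eremenko–Lyubich class 𝓑. -/
open Complex Set Filter Topology Metric MeasureTheory
open scoped ENNReal Real

noncomputable def logPlus (x : ℝ) : ℝ := max 0 (Real.log x)

noncomputable def entireOrder (f : ℂ → ℂ) : ℝ≥0∞ :=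
  Filter.limsup
    (fun z : ℂ => ENNReal.ofReal (logPlus (logPlus ‖f z‖) / Real.log ‖z‖))
    (Filter.comap (fun z : ℂ => ‖z‖) Filter.atTop)

def IsRegularValue (f : ℂ → ℂ) (w : ℂ) : Prop :=
  ∃ U : Set ℂ, IsOpen U ∧ w ∈ U ∧
    ∀ z ∈ f ⁻¹' U,
      ∃ e : ↥(connectedComponentIn (f ⁻¹' U) z) ≃ₜ ↥U,
        ∀ x : ↥(connectedComponentIn (f ⁻¹' U) z), (e x : ℂ) = f ↑x

def singularSet (f : ℂ → ℂ) : Set ℂ := {w : ℂ | ¬ IsRegularValue f w}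

def TranscendentalEntire (f : ℂ → ℂ) : Prop :=
  Differentiable ℂ f ∧ ¬ ∃ p : Polynomial ℂ, ∀ z, f z = p.eval z

def TopEquiv (f g : ℂ → ℂ) : Prop :=
  ∃ φ ψ : ℂ ≃ₜ ℂ, ∀ z, ψ (f z) = g (φ z)

noncomputable def cylArea (A : Set ℂ) : ℝ≥0∞ :=
  ∫⁻ z in A, ENNReal.ofReal (1 / ‖z‖ ^ 2)

def AreaProperty (f : ℂ → ℂ) : Prop :=
  ∀ K : Set ℂ, IsCompact K → K ⊆ (singularSet f)ᶜ →
    cylArea (f ⁻¹' K \ Metric.ball (0 : ℂ) 1) < ⊤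

/-- The polynomial `4 X ^ k (X ^ k - 1)` in the coordinate `X = 1 + y`, i.e. `(1 - 2 X ^ k) ^ 2`
conjugated so that its repelling fixed point `1` is moved to `0`. -/
def roomMap (k : ℕ) (y : ℂ) : ℂ := 4 * (1 + y) ^ k * ((1 + y) ^ k - 1)

/-- The composition `roomMap (m 0) ∘ ⋯ ∘ roomMap (m (n - 1))`. -/
def roomComp : ℕ → (ℕ → ℕ) → ℂ → ℂ
  | 0, _, y => y
  | n + 1, m, y => roomMap (m 0) (roomComp n (fun k => m (k + 1)) y)

/-- The multiplier at `0` of `roomComp n m`. -/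
def roomScale (n : ℕ) (m : ℕ → ℕ) : ℝ := ∏ k ∈ Finset.range n, (4 * m k : ℝ)

/-- The composition `roomComp n m`, rescaled to have derivative `1` at `0`. -/
noncomputable def roomApprox (n : ℕ) (m : ℕ → ℕ) (v : ℂ) : ℂ := roomComp n m (v / roomScale n m)

/-- The limit of the rescaled compositions. -/
noncomputable def roomLimit (m : ℕ → ℕ) (v : ℂ) : ℂ := limUnder atTop fun n => roomApprox n m v

lemma norm_one_add_pow_sub_one_le_exp (t : ℂ) (j : ℕ) :
    ‖(1 + t) ^ j - 1‖ ≤ Real.exp (j * ‖t‖) - 1 := by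
  have h : ‖(1 + t) ^ j - 1‖ ≤ (1 + ‖t‖) ^ j - 1 := by
    induction j with
    | zero => simp
    | succ j ih =>
      have e : (1 + t) ^ (j + 1) - 1 = ((1 + t) ^ j - 1) * (1 + t) + t := by ring
      have h1 : ‖1 + t‖ ≤ 1 + ‖t‖ := (norm_add_le _ _).trans (by simp)
      calc ‖(1 + t) ^ (j + 1) - 1‖ ≤ ‖((1 + t) ^ j - 1)‖ * ‖1 + t‖ + ‖t‖ := by
            rw [e, ← norm_mul]; exact norm_add_le _ _
        _ ≤ ((1 + ‖t‖) ^ j - 1) * (1 + ‖t‖) + ‖t‖ := by gcongr; exact (norm_nonneg _).trans ih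
        _ = (1 + ‖t‖) ^ (j + 1) - 1 := by ring
  refine h.trans (sub_le_sub_right ?_ 1)
  rw [Real.exp_nat_mul]
  gcongr
  linarith [Real.add_one_le_exp ‖t‖]

lemma norm_one_add_pow_sub_one_le {k j : ℕ} (hk : 1 ≤ k) (hj : j ≤ k) {y : ℂ} (hy : ‖y‖ ≤ 1) :
    ‖(1 + y / (4 * k)) ^ j - 1‖ ≤ ‖y‖ / 2 := by
  have hj' : (j : ℝ) ≤ k := by exact_mod_cast hj
  have h1 : (j : ℝ) * ‖y / (4 * k)‖ ≤ ‖y‖ / 4 := by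
    rw [norm_div, norm_mul, Complex.norm_natCast, Complex.norm_ofNat]
    have : (j : ℝ) * (‖y‖ / (4 * k)) = ‖y‖ / 4 * (j / k) := by field_simp
    rw [this]
    exact mul_le_of_le_one_right (by positivity) (div_le_one_of_le₀ hj' (by linarith))
  have h2 := norm_one_add_pow_sub_one_le_exp (y / (4 * k)) j
  have h3 : |Real.exp (‖y‖ / 4) - 1| ≤ 2 * |‖y‖ / 4| :=
    Real.abs_exp_sub_one_le (by rw [abs_of_nonneg (by positivity)]; linarith)
  rw [abs_of_nonneg (by positivity : (0 : ℝ) ≤ ‖y‖ / 4)] at h3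
  have h4 := Real.exp_le_exp.2 h1
  linarith [le_abs_self (Real.exp (‖y‖ / 4) - 1)]

lemma hasDerivAt_roomMap (k : ℕ) (y : ℂ) :
    HasDerivAt (roomMap k) (4 * (2 * (1 + y) ^ k - 1) * (k * (1 + y) ^ (k - 1))) y := by
  have h : HasDerivAt (fun y : ℂ => (1 + y) ^ k) (k * (1 + y) ^ (k - 1)) y := by
    exact (((hasDerivAt_id y).const_add 1).fun_pow k).congr_deriv (by simp)
  have := (h.const_mul 4).mul (h.sub_const 1)
  refine this.congr_deriv ?_
  ring

lemma differentiable_roomMap (k : ℕ) : Differentiable ℂ (roomMap k) :=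
  fun y => (hasDerivAt_roomMap k y).differentiableAt

/-- Uniform closeness to the identity of the rescaled `roomMap`. -/
lemma norm_roomMap_sub_sub_le {k : ℕ} (hk : 1 ≤ k) {ρ : ℝ} (hρ : ρ ≤ 1) {a b : ℂ}
    (ha : ‖a‖ ≤ ρ) (hb : ‖b‖ ≤ ρ) :
    ‖roomMap k (a / (4 * k)) - roomMap k (b / (4 * k)) - (a - b)‖ ≤ 2 * ρ * ‖a - b‖ := by
  have hk0 : (k : ℂ) ≠ 0 := by exact_mod_cast (by omega : k ≠ 0)
  set φ : ℂ → ℂ := fun y => roomMap k (y / (4 * k)) - y with hφ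
  have hd : ∀ y ∈ closedBall (0 : ℂ) ρ, HasDerivWithinAt φ
      ((2 * (1 + y / (4 * k)) ^ k - 1) * (1 + y / (4 * k)) ^ (k - 1) - 1) (closedBall 0 ρ) y := by
    intro y _
    have h1 : HasDerivAt (fun y : ℂ => y / (4 * k)) (1 / (4 * k)) y :=
      (hasDerivAt_id y).div_const _
    have h2 := ((hasDerivAt_roomMap k (y / (4 * k))).comp y h1).sub (hasDerivAt_id y)
    refine (h2.congr_deriv ?_).hasDerivWithinAt
    field_simp
  have hbound : ∀ y ∈ closedBall (0 : ℂ) ρ,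
      ‖(2 * (1 + y / (4 * k)) ^ k - 1) * (1 + y / (4 * k)) ^ (k - 1) - 1‖ ≤ 2 * ρ := by
    intro y hy
    rw [mem_closedBall_zero_iff] at hy
    have hy1 : ‖y‖ ≤ 1 := hy.trans hρ
    have e1 := norm_one_add_pow_sub_one_le hk le_rfl hy1
    have e2 := norm_one_add_pow_sub_one_le hk (Nat.sub_le k 1) hy1
    set E := (1 + y / (4 * k)) ^ k
    set E₁ := (1 + y / (4 * k)) ^ (k - 1)
    have e3 : (2 * E - 1) * E₁ - 1 = 2 * ((E - 1) * (E₁ - 1)) + 2 * (E - 1) + (E₁ - 1) := by ring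
    have hn : ‖E - 1‖ * ‖E₁ - 1‖ ≤ ‖y‖ / 2 * (1 / 2) :=
      mul_le_mul e1 (by linarith) (norm_nonneg _) (by positivity)
    calc ‖(2 * E - 1) * E₁ - 1‖ ≤ 2 * (‖E - 1‖ * ‖E₁ - 1‖) + 2 * ‖E - 1‖ + ‖E₁ - 1‖ := by
          rw [e3]
          refine (norm_add_le _ _).trans (add_le_add_left ((norm_add_le _ _).trans ?_) _)
          simp
      _ ≤ 2 * ρ := by linarith
  have := (convex_closedBall (0 : ℂ) ρ).norm_image_sub_le_of_norm_hasDerivWithin_le hd hbound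
    (mem_closedBall_zero_iff.2 hb) (mem_closedBall_zero_iff.2 ha)
  calc _ = ‖φ a - φ b‖ := by congr 1; simp only [hφ]; ring
    _ ≤ _ := this

@[simp] lemma roomMap_zero (k : ℕ) : roomMap k 0 = 0 := by simp [roomMap]

@[simp] lemma roomComp_zero_right (n : ℕ) (m : ℕ → ℕ) : roomComp n m 0 = 0 := by
  induction n generalizing m with
  | zero => rfl
  | succ n ih => simp [roomComp, ih]

@[simp] lemma roomApprox_zero_right (n : ℕ) (m : ℕ → ℕ) : roomApprox n m 0 = 0 := by
  simp [roomApprox]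

lemma roomScale_succ (n : ℕ) (m : ℕ → ℕ) :
    roomScale (n + 1) m = roomScale n m * (4 * m n) := Finset.prod_range_succ _ _

lemma roomScale_succ' (n : ℕ) (m : ℕ → ℕ) :
    roomScale (n + 1) m = 4 * m 0 * roomScale n (fun k => m (k + 1)) := by
  rw [roomScale, Finset.prod_range_succ', mul_comm]; rfl

lemma roomScale_add (n j : ℕ) (m : ℕ → ℕ) :
    roomScale (n + j) m = roomScale n m * roomScale j (fun k => m (k + n)) := by
  simp only [roomScale, Finset.prod_range_add, add_comm]

lemma roomComp_add (n j : ℕ) (m : ℕ → ℕ) (y : ℂ) :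
    roomComp (n + j) m y = roomComp n m (roomComp j (fun k => m (k + n)) y) := by
  induction n generalizing m with
  | zero => simp [roomComp]
  | succ n ih =>
    rw [Nat.add_right_comm, roomComp, roomComp, ih]
    simp only [add_assoc]

lemma differentiable_roomComp (n : ℕ) (m : ℕ → ℕ) : Differentiable ℂ (roomComp n m) := by
  induction n generalizing m with
  | zero => exact differentiable_id
  | succ n ih => exact (differentiable_roomMap _).comp (ih _)

lemma pow_le_roomScale {m : ℕ → ℕ} (hm : ∀ k, 2 ≤ m k) (n : ℕ) : (8 : ℝ) ^ n ≤ roomScale n m := by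
  induction n with
  | zero => simp [roomScale]
  | succ n ih =>
    have : (2 : ℝ) ≤ m n := by exact_mod_cast hm n
    rw [roomScale_succ, pow_succ]
    exact mul_le_mul ih (by linarith) (by norm_num) ((by positivity : (0 : ℝ) ≤ 8 ^ n).trans ih)

lemma roomScale_pos {m : ℕ → ℕ} (hm : ∀ k, 2 ≤ m k) (n : ℕ) : 0 < roomScale n m :=
  (by positivity : (0 : ℝ) < 8 ^ n).trans_le (pow_le_roomScale hm n)

lemma roomApprox_succ (n : ℕ) {m : ℕ → ℕ} (hm : ∀ k, 2 ≤ m k) (v : ℂ) :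
    roomApprox (n + 1) m v = roomMap (m 0)
      (4 * m 0 * roomApprox n (fun k => m (k + 1)) (v / (4 * m 0)) / (4 * m 0)) := by
  have : (m 0 : ℂ) ≠ 0 := by exact_mod_cast (by have := hm 0; omega)
  rw [mul_div_cancel_left₀ _ (by simpa using this)]
  simp only [roomApprox, roomScale_succ', roomComp, div_div]
  push_cast
  rfl

lemma roomApprox_add (n j : ℕ) (m : ℕ → ℕ) (v : ℂ) :
    roomApprox (n + j) m v =
      roomComp n m (roomApprox j (fun k => m (k + n)) (v / roomScale n m)) := by
  simp only [roomApprox, roomComp_add, roomScale_add, div_div]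
  push_cast
  rfl

lemma norm_div_four_mul {m : ℕ → ℕ} (hm : ∀ k, 2 ≤ m k) (v : ℂ) :
    ‖v / (4 * m 0)‖ = ‖v‖ / (4 * m 0) ∧ (8 : ℝ) ≤ 4 * m 0 := by
  have : (2 : ℝ) ≤ m 0 := by exact_mod_cast hm 0
  refine ⟨by simp, by linarith⟩

/-- The rescaled compositions are uniformly close to the identity near `0`. -/
lemma norm_roomApprox_sub_sub_le (n : ℕ) {m : ℕ → ℕ} (hm : ∀ k, 2 ≤ m k) {ρ : ℝ}
    (hρ : ρ ≤ 1 / 8) {a b : ℂ} (ha : ‖a‖ ≤ ρ) (hb : ‖b‖ ≤ ρ) :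
    ‖roomApprox n m a - roomApprox n m b - (a - b)‖ ≤ 4 * ρ * ‖a - b‖ := by
  have hρ0 : 0 ≤ ρ := (norm_nonneg _).trans ha
  induction n generalizing m ρ a b with
  | zero => simp [roomApprox, roomComp, roomScale]; positivity
  | succ n ih =>
    obtain ⟨-, hl⟩ := norm_div_four_mul hm a
    rw [roomApprox_succ n hm, roomApprox_succ n hm]
    set l : ℂ := 4 * m 0 with hldef
    have hln : ‖l‖ = 4 * m 0 := by simp [hldef]
    have hl0 : l ≠ 0 := norm_pos_iff.1 (by rw [hln]; linarith)
    have hmt : ∀ k, 2 ≤ m (k + 1) := fun k => hm _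
    have key : ∀ c d : ℂ, ‖c‖ ≤ ρ → ‖d‖ ≤ ρ →
        ‖l * roomApprox n (fun k => m (k + 1)) (c / l)
          - l * roomApprox n (fun k => m (k + 1)) (d / l) - (c - d)‖ ≤ ρ / 2 * ‖c - d‖ := by
      intro c d hc hd
      have hr : ρ / ‖l‖ ≤ ρ / 8 := by rw [hln]; gcongr
      have hr0 : 0 ≤ ρ / ‖l‖ := by positivity
      have := ih hmt (ρ := ρ / ‖l‖) (a := c / l) (b := d / l) (by linarith)
        (by rw [norm_div]; gcongr) (by rw [norm_div]; gcongr) hr0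
      calc _ = ‖l * (roomApprox n (fun k => m (k + 1)) (c / l)
              - roomApprox n (fun k => m (k + 1)) (d / l) - (c / l - d / l))‖ := by
            congr 1; field_simp
        _ ≤ ‖l‖ * (4 * (ρ / ‖l‖) * ‖c / l - d / l‖) := by rw [norm_mul]; gcongr
        _ = 4 * (ρ / ‖l‖) * ‖c - d‖ := by
            rw [← sub_div, norm_div]; field_simp
        _ ≤ _ := by gcongr; linarith
    have hsz : ∀ c : ℂ, ‖c‖ ≤ ρ →
        ‖l * roomApprox n (fun k => m (k + 1)) (c / l)‖ ≤ 17 / 16 * ρ := by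
      intro c hc
      have h := key c 0 hc (by simpa)
      simp only [zero_div, roomApprox_zero_right, mul_zero, sub_zero] at h
      have h2 := norm_add_le (l * roomApprox n (fun k => m (k + 1)) (c / l) - c) c
      rw [sub_add_cancel] at h2
      have : ρ / 2 * ‖c‖ ≤ 1 / 16 * ρ := by nlinarith [norm_nonneg c]
      linarith
    have hk := key a b ha hb
    have h1 := norm_roomMap_sub_sub_le (k := m 0) (by have := hm 0; omega)
      (by linarith : 17 / 16 * ρ ≤ 1) (hsz a ha) (hsz b hb)
    rw [← hldef] at h1
    set A := l * roomApprox n (fun k => m (k + 1)) (a / l)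
    set B := l * roomApprox n (fun k => m (k + 1)) (b / l)
    have hAB : ‖A - B‖ ≤ 17 / 16 * ‖a - b‖ := by
      have h2 := norm_add_le (A - B - (a - b)) (a - b)
      rw [sub_add_cancel] at h2
      have : ρ / 2 * ‖a - b‖ ≤ 1 / 16 * ‖a - b‖ :=
        mul_le_mul_of_nonneg_right (by linarith) (norm_nonneg _)
      linarith
    have h3 := norm_add_le (roomMap (m 0) (A / l) - roomMap (m 0) (B / l) - (A - B))
      (A - B - (a - b))
    rw [sub_add_sub_cancel] at h3
    nlinarith [mul_nonneg hρ0 (norm_nonneg (a - b))]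

lemma norm_roomApprox_sub_self_le (n : ℕ) {m : ℕ → ℕ} (hm : ∀ k, 2 ≤ m k) {v : ℂ}
    (hv : ‖v‖ ≤ 1 / 8) : ‖roomApprox n m v - v‖ ≤ 1 / 2 * ‖v‖ := by
  have := norm_roomApprox_sub_sub_le n hm le_rfl hv (b := 0) (by simp)
  simp only [roomApprox_zero_right, sub_zero] at this
  linarith

lemma dist_roomApprox_succ_le (n : ℕ) {m : ℕ → ℕ} (hm : ∀ k, 2 ≤ m k) {v : ℂ}
    (hv : ‖v‖ ≤ 1 / 8) :
    dist (roomApprox n m v) (roomApprox (n + 1) m v) ≤ 2 * ‖v‖ ^ 2 * (1 / 4) ^ n := by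
  rw [dist_comm, dist_eq_norm]
  induction n generalizing m v with
  | zero =>
    have h := norm_roomMap_sub_sub_le (k := m 0) (by have := hm 0; omega)
      (by linarith : ‖v‖ ≤ 1) le_rfl (b := 0) (by simp)
    have : (m 0 : ℂ) ≠ 0 := by exact_mod_cast (by have := hm 0; omega)
    rw [roomApprox_succ 0 hm]
    simp only [roomApprox, roomComp, roomScale, Finset.range_zero, Finset.prod_empty, zero_div,
      roomMap_zero, sub_zero, ofReal_one, div_one, pow_zero, mul_one] at h ⊢
    rw [mul_div_cancel₀ _ (by simpa using this)]
    linarith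
  | succ n ih =>
    obtain ⟨-, hl⟩ := norm_div_four_mul hm v
    rw [roomApprox_succ (n + 1) hm, roomApprox_succ n hm]
    set l : ℂ := 4 * m 0 with hldef
    have hln : ‖l‖ = 4 * m 0 := by simp [hldef]
    have hl8 : 8 ≤ ‖l‖ := by rw [hln]; exact hl
    have hmt : ∀ k, 2 ≤ m (k + 1) := fun k => hm _
    have hvl : ‖v / l‖ ≤ 1 / 8 := by
      rw [norm_div]; exact (div_le_self (norm_nonneg _) (by linarith)).trans hv
    have hsz : ∀ j, ‖l * roomApprox j (fun k => m (k + 1)) (v / l)‖ ≤ 3 / 16 := by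
      intro j
      have h := norm_roomApprox_sub_self_le j hmt hvl
      have h2 := norm_add_le (roomApprox j (fun k => m (k + 1)) (v / l) - v / l) (v / l)
      rw [sub_add_cancel] at h2
      calc _ ≤ ‖l‖ * (3 / 2 * ‖v / l‖) := by rw [norm_mul]; gcongr; linarith
        _ = 3 / 2 * ‖v‖ := by rw [norm_div]; field_simp
        _ ≤ _ := by linarith
    have hi := ih hmt hvl
    have h1 := norm_roomMap_sub_sub_le (k := m 0) (by have := hm 0; omega)
      (by norm_num : (3 / 16 : ℝ) ≤ 1) (hsz (n + 1)) (hsz n)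
    rw [← hldef] at h1
    set A := l * roomApprox (n + 1) (fun k => m (k + 1)) (v / l) with hA
    set B := l * roomApprox n (fun k => m (k + 1)) (v / l) with hB
    have hAB : ‖A - B‖ ≤ 1 / 8 * (2 * ‖v‖ ^ 2 * (1 / 4) ^ n) := by
      calc ‖A - B‖ ≤ ‖l‖ * (2 * ‖v / l‖ ^ 2 * (1 / 4) ^ n) := by
            rw [hA, hB, ← mul_sub, norm_mul]; gcongr
        _ = 1 / ‖l‖ * (2 * ‖v‖ ^ 2 * (1 / 4) ^ n) := by rw [norm_div]; field_simp
        _ ≤ _ := by gcongr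
    have h3 := norm_add_le (roomMap (m 0) (A / l) - roomMap (m 0) (B / l) - (A - B)) (A - B)
    rw [sub_add_cancel] at h3
    rw [pow_succ (1 / 4 : ℝ) n]
    have : 0 ≤ 2 * ‖v‖ ^ 2 * (1 / 4) ^ n := by positivity
    nlinarith

lemma exists_div_roomScale_le {m : ℕ → ℕ} (hm : ∀ k, 2 ≤ m k) (R : ℝ) :
    ∃ n, R / roomScale n m ≤ 1 / 8 := by
  obtain ⟨n, hn⟩ := pow_unbounded_of_one_lt (8 * R) (by norm_num : (1 : ℝ) < 8)
  refine ⟨n, ?_⟩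
  rw [div_le_iff₀ (roomScale_pos hm n)]
  linarith [pow_le_roomScale hm n]

lemma norm_div_roomScale {m : ℕ → ℕ} (hm : ∀ k, 2 ≤ m k) (n : ℕ) (v : ℂ) :
    ‖v / roomScale n m‖ = ‖v‖ / roomScale n m := by
  rw [norm_div, Complex.norm_real, Real.norm_of_nonneg (roomScale_pos hm n).le]

lemma tendsto_roomApprox {m : ℕ → ℕ} (hm : ∀ k, 2 ≤ m k) (v : ℂ) :
    Tendsto (fun n => roomApprox n m v) atTop (𝓝 (roomLimit m v)) := by
  suffices ∃ c, Tendsto (fun n => roomApprox n m v) atTop (𝓝 c) from tendsto_nhds_limUnder this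
  obtain ⟨n, hn⟩ := exists_div_roomScale_le hm ‖v‖
  rw [← norm_div_roomScale hm] at hn
  have hmt : ∀ k, 2 ≤ m (k + n) := fun k => hm _
  obtain ⟨c, hc⟩ := cauchySeq_tendsto_of_complete
    (cauchySeq_of_le_geometric _ _ (by norm_num)
      fun j => dist_roomApprox_succ_le j hmt hn)
  refine ⟨roomComp n m c, (tendsto_add_atTop_iff_nat n).1 ?_⟩
  rw [funext fun j => show roomApprox (j + n) m v = _ by rw [add_comm, roomApprox_add]]
  exact ((differentiable_roomComp n m).continuous.tendsto c).comp hc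

/-- The functional equation of the limit function. -/
lemma roomLimit_eq_roomComp {m : ℕ → ℕ} (hm : ∀ k, 2 ≤ m k) (n : ℕ) (v : ℂ) :
    roomLimit m v = roomComp n m (roomLimit (fun k => m (k + n)) (v / roomScale n m)) := by
  have h := (tendsto_add_atTop_iff_nat n).2 (tendsto_roomApprox hm v)
  rw [funext fun j => show roomApprox (j + n) m v = _ by rw [add_comm, roomApprox_add]] at h
  exact tendsto_nhds_unique h
    (((differentiable_roomComp n m).continuous.tendsto _).comp
      (tendsto_roomApprox (m := fun k => m (k + n)) (fun k => hm _) (v / roomScale n m)))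

lemma norm_roomLimit_sub_sub_le {m : ℕ → ℕ} (hm : ∀ k, 2 ≤ m k) {a b : ℂ}
    (ha : ‖a‖ ≤ 1 / 8) (hb : ‖b‖ ≤ 1 / 8) :
    ‖roomLimit m a - roomLimit m b - (a - b)‖ ≤ 1 / 2 * ‖a - b‖ := by
  refine le_of_tendsto (((tendsto_roomApprox hm a).sub (tendsto_roomApprox hm b)).sub_const
    (a - b)).norm (Eventually.of_forall fun n => ?_)
  have := norm_roomApprox_sub_sub_le n hm le_rfl ha hb
  linarith

@[simp] lemma roomLimit_zero (m : ℕ → ℕ) : roomLimit m 0 = 0 := by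
  simpa [roomLimit] using (tendsto_const_nhds (x := (0 : ℂ)) (f := atTop (α := ℕ))).limUnder_eq

lemma norm_roomLimit_sub_self_le {m : ℕ → ℕ} (hm : ∀ k, 2 ≤ m k) {v : ℂ}
    (hv : ‖v‖ ≤ 1 / 8) : ‖roomLimit m v - v‖ ≤ 1 / 2 * ‖v‖ := by
  simpa using norm_roomLimit_sub_sub_le hm hv (b := 0) (by simp)

lemma differentiable_roomLimit {m : ℕ → ℕ} (hm : ∀ k, 2 ≤ m k) :
    Differentiable ℂ (roomLimit m) := by
  have hball : ∀ {m : ℕ → ℕ}, (∀ k, 2 ≤ m k) →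
      DifferentiableOn ℂ (roomLimit m) (ball 0 (1 / 8)) := by
    intro m hm
    have hu : TendstoUniformlyOn (fun n => roomApprox n m) (roomLimit m) atTop (ball 0 (1 / 8)) := by
      rw [Metric.tendstoUniformlyOn_iff]
      intro ε hε
      have h0 : Tendsto (fun n : ℕ => (1 / 4 : ℝ) ^ n) atTop (𝓝 0) :=
        tendsto_pow_atTop_nhds_zero_of_lt_one (by norm_num) (by norm_num)
      filter_upwards [h0.eventually_lt_const hε] with n hn v hv
      have hv' : ‖v‖ ≤ 1 / 8 := (mem_ball_zero_iff.1 hv).le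
      have h := dist_le_of_le_geometric_of_tendsto _ _ (by norm_num)
        (fun j => dist_roomApprox_succ_le j hm hv') (tendsto_roomApprox hm v) n
      rw [dist_comm]
      have : 2 * ‖v‖ ^ 2 ≤ 1 / 32 := by nlinarith [norm_nonneg v]
      rw [le_div_iff₀ (by norm_num)] at h
      have h2 : 2 * ‖v‖ ^ 2 * (1 / 4 : ℝ) ^ n ≤ 1 / 32 * (1 / 4 : ℝ) ^ n := by gcongr
      linarith
    refine hu.tendstoLocallyUniformlyOn.differentiableOn (Eventually.of_forall fun n => ?_)
      isOpen_ball
    exact ((differentiable_roomComp n m).comp (differentiable_id.div_const _)).differentiableOn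
  intro v
  obtain ⟨n, hn⟩ := exists_div_roomScale_le hm (‖v‖ + 1)
  have hpos := roomScale_pos hm n
  rw [show roomLimit m = fun v => roomComp n m
    (roomLimit (fun k => m (k + n)) (v / roomScale n m)) from
    funext fun v => roomLimit_eq_roomComp hm n v]
  have hin : v / roomScale n m ∈ ball (0 : ℂ) (1 / 8) := by
    rw [mem_ball_zero_iff, norm_div_roomScale hm]
    exact (div_lt_div_of_pos_right (by linarith) hpos).trans_le hn
  have h1 : DifferentiableAt ℂ (roomLimit (fun k => m (k + n))) (v / roomScale n m) :=
    (hball (m := fun k => m (k + n)) fun k => hm _).differentiableAt (isOpen_ball.mem_nhds hin)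
  have h2 : DifferentiableAt ℂ (fun v : ℂ => v / roomScale n m) v := differentiableAt_id.div_const _
  exact DifferentiableAt.comp (g := roomComp n m) v (differentiable_roomComp n m _)
    (DifferentiableAt.comp (g := roomLimit fun k => m (k + n)) v h1 h2)

/-- The limit function is a homeomorphism from `ball 0 (1 / 8)` onto an open set containing
`ball 0 (1 / 20)`. -/
lemma exists_openPartialHomeomorph_roomLimit {m : ℕ → ℕ} (hm : ∀ k, 2 ≤ m k) :
    ∃ e : OpenPartialHomeomorph ℂ ℂ, (e : ℂ → ℂ) = roomLimit m ∧ e.source = ball 0 (1 / 8) ∧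
      ball 0 (1 / 20) ⊆ e.target := by
  have happ : ApproximatesLinearOn (roomLimit m)
      (ContinuousLinearEquiv.refl ℂ ℂ : ℂ →L[ℂ] ℂ) (ball 0 (1 / 8)) (1 / 2) := by
    intro x hx y hy
    simpa using norm_roomLimit_sub_sub_le hm (mem_ball_zero_iff.1 hx).le (mem_ball_zero_iff.1 hy).le
  have hnorm : ‖((ContinuousLinearEquiv.refl ℂ ℂ).symm : ℂ →L[ℂ] ℂ)‖₊ = 1 := by
    simp
  have hc : Subsingleton ℂ ∨
      (1 / 2 : NNReal) < ‖((ContinuousLinearEquiv.refl ℂ ℂ).symm : ℂ →L[ℂ] ℂ)‖₊⁻¹ := by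
    right
    rw [hnorm, inv_one]
    exact NNReal.half_lt_self one_ne_zero
  refine ⟨happ.toOpenPartialHomeomorph _ _ hc isOpen_ball, rfl, rfl, ?_⟩
  have h := happ.closedBall_subset_target hc isOpen_ball (ε := 1 / 10) (b := 0) (by norm_num)
    (closedBall_subset_ball (by norm_num))
  rw [hnorm, roomLimit_zero] at h
  refine (ball_subset_closedBall.trans (closedBall_subset_closedBall ?_)).trans h
  norm_num

/-- A nonvanishing holomorphic function on a disc has a holomorphic logarithm. -/
lemma exists_exp_eq_on_ball {φ : ℂ → ℂ} {c : ℂ} {r : ℝ} (hr : 0 < r)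
    (hφ : DifferentiableOn ℂ φ (ball c r)) (h0 : ∀ w ∈ ball c r, φ w ≠ 0) :
    ∃ h : ℂ → ℂ, DifferentiableOn ℂ h (ball c r) ∧ ∀ w ∈ ball c r, exp (h w) = φ w := by
  obtain ⟨g, hg, hg'⟩ := ((hφ.deriv isOpen_ball).div hφ h0).isExactOn_ball.with_val_at c (log (φ c))
  have hc : c ∈ ball c r := mem_ball_self hr
  refine ⟨g, fun w hw => (hg' w hw).differentiableAt.differentiableWithinAt, fun w hw => ?_⟩
  have hder : ∀ x ∈ ball c r, HasDerivWithinAt (fun x => φ x * exp (-g x)) 0 (ball c r) x := by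
    intro x hx
    have h1 := (hφ.differentiableAt (isOpen_ball.mem_nhds hx)).hasDerivAt
    refine ((h1.mul (hg' x hx).neg.cexp).congr_deriv ?_).hasDerivWithinAt
    have := h0 x hx
    simp only [Pi.div_apply]
    field_simp
    ring
  have hconst := (convex_ball c r).norm_image_sub_le_of_norm_hasDerivWithin_le (C := 0) hder
    (by simp) hc hw
  rw [zero_mul, norm_le_zero_iff, sub_eq_zero, hg, exp_neg, exp_neg, exp_log (h0 c hc),
    mul_inv_cancel₀ (h0 c hc)] at hconst
  exact (mul_inv_eq_one₀ (exp_ne_zero _)).1 hconst |>.symm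

lemma exists_pow_eq_on_ball {φ : ℂ → ℂ} {c x₀ : ℂ} {r : ℝ} (hr : 0 < r)
    (hφ : DifferentiableOn ℂ φ (ball c r)) (h0 : ∀ w ∈ ball c r, φ w ≠ 0) {k : ℕ} (hk : k ≠ 0)
    (hx : x₀ ^ k = φ c) :
    ∃ g : ℂ → ℂ, DifferentiableOn ℂ g (ball c r) ∧ (∀ w ∈ ball c r, g w ^ k = φ w) ∧ g c = x₀ := by
  obtain ⟨h, hd, he⟩ := exists_exp_eq_on_ball hr hφ h0
  have hc : c ∈ ball c r := mem_ball_self hr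
  have hk' : (k : ℂ) ≠ 0 := by exact_mod_cast hk
  refine ⟨fun w => x₀ * exp ((h w - h c) / k), ?_, fun w hw => ?_, by simp⟩
  · exact (((hd.sub_const _).div_const _).cexp).const_mul _
  · rw [mul_pow, ← exp_nat_mul, mul_div_cancel₀ _ hk', exp_sub, he w hw, he c hc, hx,
      mul_div_cancel₀ _ (h0 c hc)]

/-- Holomorphic inverse branches of `roomMap k` on discs avoiding its critical values. -/
lemma exists_lift_roomMap {φ : ℂ → ℂ} {c y : ℂ} {r R : ℝ} (hr : 0 < r) (hR : 1 ≤ R)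
    (hφ : DifferentiableOn ℂ φ (ball c r))
    (h : ∀ w ∈ ball c r, φ w ≠ 0 ∧ φ w ≠ -1 ∧ ‖1 + φ w‖ ≤ R) {k : ℕ} (hk : k ≠ 0)
    (hy : roomMap k y = φ c) :
    ∃ ψ : ℂ → ℂ, DifferentiableOn ℂ ψ (ball c r) ∧
      (∀ w ∈ ball c r, ψ w ≠ 0 ∧ ψ w ≠ -1 ∧ ‖1 + ψ w‖ ≤ R) ∧
      (∀ w ∈ ball c r, roomMap k (ψ w) = φ w) ∧ ψ c = y := by
  obtain ⟨s, hsd, hs, hsc⟩ := exists_pow_eq_on_ball (x₀ := 2 * (1 + y) ^ k - 1) hr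
    (hφ.const_add 1) (fun w hw h' => (h w hw).2.1 (by linear_combination h')) two_ne_zero
    (by rw [← hy, roomMap]; ring)
  have hs1 : ∀ w ∈ ball c r, (1 + s w) / 2 ≠ 0 := by
    intro w hw h'
    refine (h w hw).1 ?_
    have : s w = -1 := by linear_combination 2 * h'
    have h2 := hs w hw
    rw [this] at h2
    linear_combination -h2
  obtain ⟨x, hxd, hx, hxc⟩ := exists_pow_eq_on_ball (x₀ := 1 + y) hr
    ((hsd.const_add 1).div_const 2) hs1 hk (by simp only [hsc]; ring)
  have hmap : ∀ w ∈ ball c r, roomMap k (x w - 1) = φ w := by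
    intro w hw
    rw [roomMap, add_sub_cancel, hx w hw]
    linear_combination hs w hw
  refine ⟨fun w => x w - 1, hxd.sub_const 1, fun w hw => ⟨fun h' => ?_, fun h' => ?_, ?_⟩, hmap,
    by simp [hxc]⟩
  · have := hmap w hw
    rw [show x w - 1 = 0 from h', roomMap_zero] at this
    exact (h w hw).1 this.symm
  · have h2 := hx w hw
    rw [show x w = 0 by linear_combination h', zero_pow hk] at h2
    exact hs1 w hw h2.symm
  · rw [add_sub_cancel]
    by_contra! hlt
    have h1 : ‖s w‖ ^ 2 ≤ R := by
      rw [← norm_pow, hs w hw]; exact (h w hw).2.2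
    have h2 : ‖x w‖ ^ k ≤ (1 + ‖s w‖) / 2 := by
      rw [← norm_pow, hx w hw, norm_div, Complex.norm_ofNat]
      gcongr
      exact (norm_add_le _ _).trans (by simp)
    have h3 := le_self_pow₀ (hR.trans hlt.le) hk
    nlinarith [norm_nonneg (s w)]

lemma exists_lift_roomComp (n : ℕ) {m : ℕ → ℕ} (hm : ∀ k, 2 ≤ m k) {φ : ℂ → ℂ} {c y : ℂ}
    {r R : ℝ} (hr : 0 < r) (hR : 1 ≤ R) (hφ : DifferentiableOn ℂ φ (ball c r))
    (h : ∀ w ∈ ball c r, φ w ≠ 0 ∧ φ w ≠ -1 ∧ ‖1 + φ w‖ ≤ R) (hy : roomComp n m y = φ c) :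
    ∃ ψ : ℂ → ℂ, DifferentiableOn ℂ ψ (ball c r) ∧
      (∀ w ∈ ball c r, ψ w ≠ 0 ∧ ψ w ≠ -1 ∧ ‖1 + ψ w‖ ≤ R) ∧
      (∀ w ∈ ball c r, roomComp n m (ψ w) = φ w) ∧ ψ c = y := by
  induction n generalizing m φ with
  | zero => exact ⟨φ, hφ, h, fun _ _ => rfl, hy.symm⟩
  | succ n ih =>
    obtain ⟨φ', hd', h', hl', hc'⟩ := exists_lift_roomMap hr hR hφ h
      (by have := hm 0; omega : m 0 ≠ 0) hy
    obtain ⟨ψ, hd, hb, hl, hc⟩ := ih (m := fun k => m (k + 1)) (fun k => hm _) hd' h' hc'.symm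
    exact ⟨ψ, hd, hb, fun w hw => by rw [roomComp, hl w hw, hl' w hw], hc⟩

/-- A form of Harnack's inequality. -/
lemma norm_sq_le_of_ne_zero_on_ball {u : ℂ → ℂ} {c w : ℂ} {r M : ℝ} (hr : 0 < r)
    (hu : DifferentiableOn ℂ u (ball c r)) (h0 : ∀ w ∈ ball c r, u w ≠ 0)
    (hM : ∀ w ∈ ball c r, ‖u w‖ < M) (hw : ‖w - c‖ ≤ r / 5) : ‖u w‖ ^ 2 ≤ M * ‖u c‖ := by
  obtain ⟨h, hd, he⟩ := exists_exp_eq_on_ball hr hu h0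
  have hc : c ∈ ball c r := mem_ball_self hr
  have hshift : ∀ z ∈ ball (0 : ℂ) r, c + z ∈ ball c r := fun z hz => by
    simpa [mem_ball_iff_norm] using hz
  have hre : ∀ z ∈ ball c r, (h z).re = Real.log ‖u z‖ := fun z hz => by
    rw [← he z hz, norm_exp, Real.log_exp]
  have hpos : ∀ z ∈ ball c r, 0 < ‖u z‖ := fun z hz => norm_pos_iff.2 (h0 z hz)
  have hMpos : 0 < M := (hpos c hc).trans (hM c hc)
  have hwr : w - c ∈ ball (0 : ℂ) r := mem_ball_zero_iff.2 (by linarith)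
  have hwc : w ∈ ball c r := by simpa using hshift _ hwr
  have hL : 0 < Real.log M - Real.log ‖u c‖ := sub_pos.2 (Real.log_lt_log (hpos c hc) (hM c hc))
  have hBC := borelCaratheodory_zero (f := fun z => h (c + z) - h c) hL
    ((hd.comp (by fun_prop) hshift).sub_const _)
    (fun z hz => by
      simp only [mem_ofPred_eq, sub_re, hre _ (hshift z hz), hre c hc]
      exact sub_le_sub_right (Real.log_le_log (hpos _ (hshift z hz)) (hM _ (hshift z hz)).le) _)
    hr hwr (by simp)
  simp only [add_sub_cancel] at hBC
  have h2 : (h w - h c).re ≤ (Real.log M - Real.log ‖u c‖) / 2 := by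
    refine (re_le_norm _).trans (hBC.trans ?_)
    rw [div_le_iff₀ (by linarith)]
    nlinarith
  rw [sub_re, hre w hwc, hre c hc] at h2
  rw [← Real.log_le_log_iff (pow_pos (hpos w hwc) 2) (mul_pos hMpos (hpos c hc)), Real.log_pow,
    Real.log_mul hMpos.ne' (hpos c hc).ne']
  push_cast
  linarith

/-- A continuous right inverse with open image parametrizes a component of the preimage. -/
lemma connectedComponentIn_preimage_eq_image {f g : ℂ → ℂ} {U : Set ℂ} {z : ℂ}
    (hf : Continuous f) (hU : IsOpen U) (hUc : IsPreconnected U) (hg : ContinuousOn g U)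
    (hfg : ∀ w ∈ U, f (g w) = w) (hgo : IsOpen (g '' U)) (hz : z ∈ f ⁻¹' U) (hgz : g (f z) = z) :
    connectedComponentIn (f ⁻¹' U) z = g '' U := by
  have hsub : g '' U ⊆ f ⁻¹' U := by
    rintro _ ⟨w, hw, rfl⟩
    rwa [mem_preimage, hfg w hw]
  have hzg : z ∈ g '' U := ⟨f z, hz, hgz⟩
  refine subset_antisymm ?_ ((hUc.image g hg).subset_connectedComponentIn hzg hsub)
  have hopen : IsOpen (f ⁻¹' U ∩ {x | g (f x) - x ≠ 0}) :=
    ((hg.comp hf.continuousOn (mapsTo_preimage f U)).sub continuousOn_id).isOpen_inter_preimage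
      (hU.preimage hf) isOpen_ne
  refine isPreconnected_connectedComponentIn.subset_left_of_subset_union hgo hopen ?_ ?_
    ⟨z, mem_connectedComponentIn hz, hzg⟩
  · rw [Set.disjoint_left]
    rintro _ ⟨w, hw, rfl⟩ ⟨-, h⟩
    exact h (by rw [hfg w hw, sub_self])
  · intro x hx
    have hxU := connectedComponentIn_subset _ _ hx
    by_cases h : g (f x) = x
    · exact Or.inl ⟨f x, hxU, h⟩
    · exact Or.inr ⟨hxU, sub_ne_zero.2 h⟩

lemma exists_homeomorph_connectedComponentIn {f g : ℂ → ℂ} {U : Set ℂ} {z : ℂ}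
    (hf : Continuous f) (hU : IsOpen U) (hUc : IsPreconnected U) (hg : ContinuousOn g U)
    (hfg : ∀ w ∈ U, f (g w) = w) (hgo : IsOpen (g '' U)) (hz : z ∈ f ⁻¹' U) (hgz : g (f z) = z) :
    ∃ e : connectedComponentIn (f ⁻¹' U) z ≃ₜ U, ∀ x, (e x : ℂ) = f x := by
  rw [connectedComponentIn_preimage_eq_image hf hU hUc hg hfg hgo hz hgz]
  have hmaps : ∀ x : g '' U, f x ∈ U := by
    rintro ⟨_, w, hw, rfl⟩
    simpa only [hfg w hw] using hw
  refine ⟨{ toFun := fun x => ⟨f x, hmaps x⟩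
            invFun := fun w => ⟨g w, mem_image_of_mem g w.2⟩
            left_inv := by
              rintro ⟨_, w, hw, rfl⟩
              exact Subtype.ext (by simp only [hfg w hw])
            right_inv := fun w => Subtype.ext (hfg w w.2)
            continuous_toFun := (hf.comp continuous_subtype_val).subtype_mk _
            continuous_invFun := (continuousOn_iff_continuous_domRestrict.1 hg).subtype_mk _ },
    fun _ => rfl⟩

lemma exists_norm_roomLimit_div_lt {m : ℕ → ℕ} (hm : ∀ k, 2 ≤ m k) (z : ℂ) {C : ℝ} (hC : 1 ≤ C) :
    ∃ n, ‖z / roomScale n m‖ < 1 / 8 ∧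
      C * ‖roomLimit (fun k => m (k + n)) (z / roomScale n m)‖ < 1 / 400 := by
  obtain ⟨n, hn⟩ := exists_div_roomScale_le hm (100 * C * (‖z‖ + 1))
  have hpos := roomScale_pos hm n
  have h1 : 100 * C * ‖z / roomScale n m‖ < 1 / 8 := by
    rw [norm_div_roomScale hm]
    refine lt_of_lt_of_le ?_ hn
    rw [← mul_div_assoc]
    gcongr
    linarith
  have h2 : ‖z / roomScale n m‖ < 1 / 8 := by nlinarith
  have h3 := norm_roomLimit_sub_self_le (m := fun k => m (k + n)) (fun k => hm _) h2.le
  have h4 := norm_add_le (roomLimit (fun k => m (k + n)) (z / roomScale n m) - z / roomScale n m)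
    (z / roomScale n m)
  rw [sub_add_cancel] at h4
  refine ⟨n, h2, ?_⟩
  have h5 : C * ‖roomLimit (fun k => m (k + n)) (z / roomScale n m)‖
      ≤ C * (3 / 2 * ‖z / roomScale n m‖) := by gcongr; linarith
  linarith

lemma isRegularValue_roomLimit {m : ℕ → ℕ} (hm : ∀ k, 2 ≤ m k) {w₀ : ℂ} (h0 : w₀ ≠ 0)
    (h1 : w₀ ≠ -1) : IsRegularValue (roomLimit m) w₀ := by
  have hd1 : 0 < ‖w₀ + 1‖ := norm_pos_iff.2 fun h => h1 (by linear_combination h)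
  obtain ⟨r, hr, hr0, hr1⟩ : ∃ r : ℝ, 0 < r ∧ 11 * r ≤ ‖w₀‖ ∧ 11 * r ≤ ‖w₀ + 1‖ :=
    ⟨min ‖w₀‖ ‖w₀ + 1‖ / 11, by positivity, by linarith [min_le_left ‖w₀‖ ‖w₀ + 1‖],
      by linarith [min_le_right ‖w₀‖ ‖w₀ + 1‖]⟩
  refine ⟨ball w₀ r, isOpen_ball, mem_ball_self hr, fun z hz => ?_⟩
  have hzr : ‖roomLimit m z - w₀‖ < r := mem_ball_iff_norm.1 hz
  set R : ℝ := 1 + ‖roomLimit m z‖ + 10 * r with hR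
  have hR1 : 1 ≤ R := by rw [hR]; linarith [norm_nonneg (roomLimit m z)]
  obtain ⟨n, hzn, hyn⟩ := exists_norm_roomLimit_div_lt hm z (by linarith : 1 ≤ R + 2)
  have hpos := roomScale_pos hm n
  have hposC : (roomScale n m : ℂ) ≠ 0 := by exact_mod_cast hpos.ne'
  set m' : ℕ → ℕ := fun k => m (k + n) with hm'
  have hbd : ∀ w ∈ ball (roomLimit m z) (10 * r), w ≠ 0 ∧ w ≠ -1 ∧ ‖1 + w‖ ≤ R := by
    intro w hw
    rw [mem_ball_iff_norm] at hw
    have hww : ‖w - w₀‖ < 11 * r := by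
      have := norm_add_le (w - roomLimit m z) (roomLimit m z - w₀)
      rw [sub_add_sub_cancel] at this
      linarith
    refine ⟨?_, ?_, ?_⟩
    · rintro rfl
      rw [zero_sub, norm_neg] at hww
      linarith
    · rintro rfl
      rw [show (-1 - w₀ : ℂ) = -(w₀ + 1) by ring, norm_neg] at hww
      linarith
    · have h2 := norm_add_le (1 : ℂ) w
      have h3 := norm_add_le (w - roomLimit m z) (roomLimit m z)
      rw [sub_add_cancel] at h3
      rw [norm_one] at h2
      linarith
  obtain ⟨ψ, hψd, hψb, hψ, hψz⟩ := exists_lift_roomComp n hm (by linarith : 0 < 10 * r) hR1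
    differentiableOn_id hbd (roomLimit_eq_roomComp hm n z).symm
  simp only [id] at hψ
  have hsub : ball w₀ r ⊆ ball (roomLimit m z) (10 * r) := by
    intro w hw
    rw [mem_ball_iff_norm] at hw ⊢
    have := norm_sub_le (w - w₀) (roomLimit m z - w₀)
    rw [sub_sub_sub_cancel_right] at this
    linarith
  obtain ⟨e, he, hes, het⟩ := exists_openPartialHomeomorph_roomLimit (m := m') fun k => hm _
  have hψs : ∀ w ∈ ball w₀ r, ψ w ∈ e.target := by
    intro w hw
    refine het (mem_ball_zero_iff.2 ?_)
    have hwz : ‖w - roomLimit m z‖ ≤ 10 * r / 5 := by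
      rw [mem_ball_iff_norm] at hw
      have := norm_sub_le (w - w₀) (roomLimit m z - w₀)
      rw [sub_sub_sub_cancel_right] at this
      linarith
    have h2 := norm_sq_le_of_ne_zero_on_ball (M := R + 2) (by linarith : 0 < 10 * r) hψd
      (fun w hw => (hψb w hw).1) (fun w hw => by
        have h3 := norm_sub_le (1 + ψ w) 1
        rw [add_sub_cancel_left, norm_one] at h3
        linarith [(hψb w hw).2.2]) hwz
    rw [hψz] at h2
    exact lt_of_pow_lt_pow_left₀ 2 (by norm_num) (by linarith)
  have hopen : IsOpen (ψ '' ball w₀ r) := by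
    rcases ((hψd.mono hsub).analyticOnNhd isOpen_ball).is_constant_or_isOpen
      (convex_ball w₀ r).isPreconnected with ⟨c, hc⟩ | h
    · have hw2 : w₀ + (r / 2 : ℝ) ∈ ball w₀ r := by
        rw [mem_ball_iff_norm, add_sub_cancel_left, Complex.norm_real, Real.norm_of_nonneg] <;>
          linarith
      have hw1 := mem_ball_self (x := w₀) hr
      have h2 : w₀ = w₀ + (r / 2 : ℝ) := by
        calc w₀ = roomComp n m (ψ w₀) := (hψ _ (hsub hw1)).symm
          _ = roomComp n m (ψ (w₀ + (r / 2 : ℝ))) := by rw [hc _ hw1, hc _ hw2]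
          _ = _ := hψ _ (hsub hw2)
      have h3 : ((r / 2 : ℝ) : ℂ) = 0 := by linear_combination -h2
      rw [ofReal_eq_zero] at h3
      linarith
    · exact h _ subset_rfl isOpen_ball
  have himg : ψ '' ball w₀ r ⊆ e.target := by
    rintro _ ⟨w, hw, rfl⟩
    exact hψs w hw
  refine exists_homeomorph_connectedComponentIn (g := fun w => roomScale n m * e.symm (ψ w))
    (differentiable_roomLimit hm).continuous isOpen_ball (convex_ball w₀ r).isPreconnected
    ?_ ?_ ?_ hz ?_
  · exact continuousOn_const.mul (e.continuousOn_symm.comp (hψd.continuousOn.mono hsub) hψs)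
  · intro w hw
    rw [roomLimit_eq_roomComp hm n, mul_div_cancel_left₀ _ hposC, ← he, e.right_inv (hψs w hw),
      hψ w (hsub hw)]
  · have h2 := (Homeomorph.mulLeft₀ _ hposC).isOpenMap _
      (e.isOpen_image_symm_of_subset_target hopen himg)
    rwa [image_image, image_image] at h2
  · rw [hψz, ← he, e.left_inv, mul_div_cancel₀ _ hposC]
    rw [hes]
    exact mem_ball_zero_iff.2 hzn

lemma singularSet_roomLimit_subset {m : ℕ → ℕ} (hm : ∀ k, 2 ≤ m k) :
    singularSet (roomLimit m) ⊆ {0, -1} := by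
  intro w hw
  by_contra! h
  simp only [mem_insert_iff, mem_singleton_iff, not_or] at h
  exact hw (isRegularValue_roomLimit hm h.1 h.2)

lemma volume_Icc_reProdIm_Icc (a b c d : ℝ) :
    volume (Icc a b ×ℂ Icc c d) = ENNReal.ofReal (b - a) * ENNReal.ofReal (d - c) := by
  have : Icc a b ×ℂ Icc c d = measurableEquivRealProd ⁻¹' (Icc a b ×ˢ Icc c d) := rfl
  rw [this, volume_preserving_equiv_real_prod.measure_preimage
    (measurableSet_Icc.prod measurableSet_Icc).nullMeasurableSet, Measure.volume_eq_prod,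
    Measure.prod_prod, Real.volume_Icc, Real.volume_Icc]

lemma volume_image_le_of_norm_deriv_le {g g' : ℂ → ℂ} {A : Set ℂ} {C : ℝ} (hA : MeasurableSet A)
    (hg : ∀ x ∈ A, HasDerivAt g (g' x) x) (hC : ∀ x ∈ A, ‖g' x‖ ≤ C) :
    volume (g '' A) ≤ ENNReal.ofReal (C ^ 2) * volume A := by
  have h := addHaar_image_le_lintegral_abs_det_fderiv volume hA
    fun x hx => ((hg x hx).hasFDerivAt.restrictScalars ℝ).hasFDerivWithinAt (s := A)
  refine h.trans ?_
  rw [← setLIntegral_const]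
  refine setLIntegral_mono measurable_const fun x hx => ENNReal.ofReal_le_ofReal ?_
  have hdet : (ContinuousLinearMap.restrictScalars ℝ
      (ContinuousLinearMap.toSpanSingleton ℂ (g' x))).det = ‖g' x‖ ^ 2 := by
    simp [ContinuousLinearMap.det, LinearMap.det_restrictScalars, Algebra.norm_complex_apply,
      normSq_eq_norm_sq]
  rw [hdet, abs_of_nonneg (by positivity)]
  gcongr
  exact hC x hx

lemma roomLimit_scale_succ {m : ℕ → ℕ} (hm : ∀ k, 2 ≤ m k) (n : ℕ) (w : ℂ) :
    roomLimit m (roomScale (n + 1) m * w) = roomApprox n m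
      (roomScale n m * roomMap (m n) (roomLimit (fun k => m (k + (n + 1))) w)) := by
  have h1 : (roomScale n m : ℂ) ≠ 0 := by exact_mod_cast (roomScale_pos hm n).ne'
  have h2 : (roomScale (n + 1) m : ℂ) ≠ 0 := by exact_mod_cast (roomScale_pos hm (n + 1)).ne'
  rw [roomLimit_eq_roomComp hm (n + 1), mul_div_cancel_left₀ _ h2, roomApprox,
    mul_div_cancel_left₀ _ h1, roomComp_add]
  simp [roomComp]

lemma one_le_roomScale {m : ℕ → ℕ} (hm : ∀ k, 2 ≤ m k) (n : ℕ) : 1 ≤ roomScale n m :=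
  (one_le_pow₀ (by norm_num)).trans (pow_le_roomScale hm n)

lemma norm_roomLimit_scale_succ {m : ℕ → ℕ} (hm : ∀ k, 2 ≤ m k) (n : ℕ) {w ξ : ℂ}
    (hw : exp ξ = 1 + roomLimit (fun k => m (k + (n + 1))) w)
    (h1 : -(Real.log (roomScale n m) + 7 * Real.log 2) ≤ m n * ξ.re)
    (h2 : m n * ξ.re ≤ -(Real.log (roomScale n m) + 6 * Real.log 2)) :
    1 / 100 ≤ ‖roomLimit m (roomScale (n + 1) m * w)‖ ∧
      ‖roomLimit m (roomScale (n + 1) m * w)‖ ≤ 1 / 2 := by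
  have hpos := roomScale_pos hm n
  have hΛ1 := one_le_roomScale hm n
  rw [roomLimit_scale_succ hm, roomMap, ← hw, ← exp_nat_mul]
  have hun : ‖exp (m n * ξ)‖ = Real.exp (m n * ξ.re) := by
    rw [norm_exp]; simp
  have e1 : Real.exp (-(Real.log (roomScale n m) + 7 * Real.log 2)) = (roomScale n m * 128)⁻¹ := by
    rw [Real.exp_neg, Real.exp_add, Real.exp_log hpos, mul_comm 7, Real.exp_mul,
      Real.exp_log two_pos]
    norm_num
  have e2 : Real.exp (-(Real.log (roomScale n m) + 6 * Real.log 2)) = (roomScale n m * 64)⁻¹ := by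
    rw [Real.exp_neg, Real.exp_add, Real.exp_log hpos, mul_comm 6, Real.exp_mul,
      Real.exp_log two_pos]
    norm_num
  have hlo := (e1.symm.le.trans (Real.exp_le_exp.2 h1)).trans hun.symm.le
  have hhi := (hun.le.trans (Real.exp_le_exp.2 h2)).trans e2.le
  set u := exp (m n * ξ)
  have hplo : 1 / 128 ≤ roomScale n m * ‖u‖ := by
    calc (1 / 128 : ℝ) = roomScale n m * (roomScale n m * 128)⁻¹ := by field_simp
      _ ≤ _ := by gcongr
  have hphi : roomScale n m * ‖u‖ ≤ 1 / 64 := by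
    calc _ ≤ roomScale n m * (roomScale n m * 64)⁻¹ := by gcongr
      _ = 1 / 64 := by field_simp
  have hu : ‖u‖ ≤ 1 / 64 := by nlinarith [norm_nonneg u]
  have hv1 : ‖u - 1‖ ≤ 65 / 64 := by
    have := norm_sub_le u 1
    rw [norm_one] at this
    linarith
  have hv2 : 63 / 64 ≤ ‖u - 1‖ := by
    have := norm_sub_norm_le 1 u
    rw [norm_one, norm_sub_rev] at this
    linarith
  have hx : ‖(roomScale n m : ℂ) * (4 * u * (u - 1))‖
      = 4 * ((roomScale n m * ‖u‖) * ‖u - 1‖) := by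
    rw [norm_mul, norm_mul, norm_mul, Complex.norm_real, Real.norm_of_nonneg hpos.le,
      Complex.norm_ofNat]
    ring
  have hx1 : 63 / 2048 ≤ ‖(roomScale n m : ℂ) * (4 * u * (u - 1))‖ := by
    rw [hx]; nlinarith
  have hx2 : ‖(roomScale n m : ℂ) * (4 * u * (u - 1))‖ ≤ 65 / 1024 := by
    rw [hx]; nlinarith
  set x := (roomScale n m : ℂ) * (4 * u * (u - 1))
  have hle := norm_roomApprox_sub_self_le n hm (v := x) (by linarith)
  have t1 := norm_sub_norm_le (roomApprox n m x) x
  have t2 := norm_sub_norm_le x (roomApprox n m x)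
  rw [norm_sub_rev] at t2
  constructor <;> linarith

lemma norm_roomLimit_le_and_mem_slitPlane {m : ℕ → ℕ} (hm : ∀ k, 2 ≤ m k) {w : ℂ} (hw : ‖w‖ ≤ 1 / 8) :
    ‖roomLimit m w‖ ≤ 3 / 16 ∧ 1 + roomLimit m w ∈ slitPlane := by
  have h1 := norm_roomLimit_sub_self_le hm hw
  have h2 := norm_sub_norm_le (roomLimit m w) w
  have h3 : ‖roomLimit m w‖ ≤ 3 / 16 := by linarith
  refine ⟨h3, Or.inl ?_⟩
  have h4 := (abs_le.1 (abs_re_le_norm (roomLimit m w))).1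
  simp only [add_re, one_re]
  linarith

/-- The map `log (1 + roomLimit m ·)` distorts area near `0` by a bounded factor. -/
lemma volume_le_volume_preimage_log_one_add_roomLimit {m : ℕ → ℕ} (hm : ∀ k, 2 ≤ m k) {E : Set ℂ}
    (hE : MeasurableSet E) (hEb : ∀ ξ ∈ E, ‖ξ‖ ≤ 1 / 64) :
    volume E ≤ 4 * volume (ball 0 (1 / 8) ∩ (fun w => log (1 + roomLimit m w)) ⁻¹' E) := by
  have hd := differentiable_roomLimit hm
  have hmeas : Measurable fun w => log (1 + roomLimit m w) :=
    (measurable_const.add hd.continuous.measurable).clog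
  set A := ball 0 (1 / 8) ∩ (fun w => log (1 + roomLimit m w)) ⁻¹' E
  have hA : MeasurableSet A := measurableSet_ball.inter (hmeas hE)
  have hsurj : E ⊆ (fun w => log (1 + roomLimit m w)) '' A := by
    intro ξ hξ
    obtain ⟨e, he, hes, het⟩ := exists_openPartialHomeomorph_roomLimit hm
    have hξ1 := hEb ξ hξ
    have hmem : exp ξ - 1 ∈ e.target := by
      refine het (mem_ball_zero_iff.2 ?_)
      linarith [norm_exp_sub_one_le (x := ξ) (by linarith)]
    have h1 := e.map_target hmem
    have h2 := e.right_inv hmem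
    rw [he] at h2
    rw [hes] at h1
    have him := abs_le.1 ((abs_im_le_norm ξ).trans hξ1)
    have h3 : log (1 + roomLimit m (e.symm (exp ξ - 1))) = ξ := by
      rw [h2, add_sub_cancel, log_exp] <;> linarith [Real.pi_gt_three]
    exact ⟨_, ⟨h1, by rwa [mem_preimage, h3]⟩, h3⟩
  have hder : ∀ w ∈ A, HasDerivAt (fun w => log (1 + roomLimit m w))
      (deriv (roomLimit m) w / (1 + roomLimit m w)) w := fun w hw =>
    ((hd w).hasDerivAt.const_add 1).clog
      (norm_roomLimit_le_and_mem_slitPlane hm (mem_ball_zero_iff.1 hw.1).le).2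
  have hbd : ∀ w ∈ A, ‖deriv (roomLimit m) w / (1 + roomLimit m w)‖ ≤ 2 := by
    intro w hw
    have hw8 := (mem_ball_zero_iff.1 hw.1).le
    have h1 : ‖deriv (roomLimit m) w‖ ≤ 3 / 2 := by
      refine norm_deriv_le_of_lip' (by norm_num) ?_
      filter_upwards [isOpen_ball.mem_nhds hw.1] with x hx
      have h2 := norm_roomLimit_sub_sub_le hm (mem_ball_zero_iff.1 hx).le hw8
      have h3 := norm_sub_norm_le (roomLimit m x - roomLimit m w) (x - w)
      linarith
    have h2 := (norm_roomLimit_le_and_mem_slitPlane hm hw8).1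
    have h3 := norm_sub_norm_le 1 (-roomLimit m w)
    rw [norm_one, norm_neg, sub_neg_eq_add] at h3
    rw [norm_div, div_le_iff₀ (by linarith)]
    linarith
  refine (measure_mono hsurj).trans ((volume_image_le_of_norm_deriv_le hA hder hbd).trans_eq ?_)
  norm_num

/-- A set of controlled location and area which is mapped into the annulus
`1 / 100 ≤ ‖z‖ ≤ 1 / 2`. -/
lemma exists_set_roomLimit {m : ℕ → ℕ} (hm : ∀ k, 2 ≤ m k) (n : ℕ)
    (hn : 128 * (Real.log (roomScale n m) + 5) ≤ m n) :
    ∃ A : Set ℂ, MeasurableSet A ∧ A ⊆ ball 0 (1 / 8) ∧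
      (∀ w ∈ A, 1 / (4 * m n) ≤ ‖w‖ ∧ 1 / 100 ≤ ‖roomLimit m (roomScale (n + 1) m * w)‖ ∧
        ‖roomLimit m (roomScale (n + 1) m * w)‖ ≤ 1 / 2) ∧
      ENNReal.ofReal (1 / (512 * m n)) ≤ volume A := by
  have hmt : ∀ k, 2 ≤ m (k + (n + 1)) := fun k => hm _
  have hM : (0 : ℝ) < m n := by exact_mod_cast (by have := hm n; omega)
  have hL : 0 ≤ Real.log (roomScale n m) := Real.log_nonneg (one_le_roomScale hm n)
  set L := Real.log (roomScale n m)
  have l1 := Real.log_two_gt_d9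
  have l2 := Real.log_two_lt_d9
  set E : Set ℂ := Icc (-(L + 7 * Real.log 2) / m n) (-(L + 6 * Real.log 2) / m n) ×ℂ
    Icc (-(1 / 128)) (1 / 128) with hEdef
  have hE : MeasurableSet E := (measurable_re measurableSet_Icc).inter
    (measurable_im measurableSet_Icc)
  have hEre : ∀ ξ ∈ E, -(L + 7 * Real.log 2) ≤ m n * ξ.re ∧ m n * ξ.re ≤ -(L + 6 * Real.log 2) := by
    intro ξ hξ
    have := hξ.1
    rwa [mem_preimage, mem_Icc, div_le_iff₀' hM, le_div_iff₀' hM] at this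
  have hEb : ∀ ξ ∈ E, ‖ξ‖ ≤ 1 / 64 := by
    intro ξ hξ
    have h1 : |ξ.im| ≤ 1 / 128 := abs_le.2 hξ.2
    obtain ⟨h2, h3⟩ := hEre ξ hξ
    have h4 : |ξ.re| ≤ 1 / 128 := by
      rw [abs_le]
      constructor <;> nlinarith
    linarith [norm_le_abs_re_add_abs_im ξ]
  have hd := differentiable_roomLimit hmt
  have hmeas : Measurable fun w => log (1 + roomLimit (fun k => m (k + (n + 1))) w) :=
    (measurable_const.add hd.continuous.measurable).clog
  refine ⟨_, measurableSet_ball.inter (hmeas hE), inter_subset_left, fun w hw => ?_, ?_⟩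
  · have hw8 := (mem_ball_zero_iff.1 hw.1).le
    have hslit := (norm_roomLimit_le_and_mem_slitPlane hmt hw8).2
    have hexp := exp_log (slitPlane_ne_zero hslit)
    have hξ : log (1 + roomLimit (fun k => m (k + (n + 1))) w) ∈ E := hw.2
    obtain ⟨h1, h2⟩ := hEre _ hξ
    have hb := hEb _ hξ
    set ξ := log (1 + roomLimit (fun k => m (k + (n + 1))) w)
    refine ⟨?_, norm_roomLimit_scale_succ hm n hexp h1 h2⟩
    have h3 := norm_roomLimit_sub_self_le hmt hw8
    have h4 := norm_sub_norm_le (roomLimit (fun k => m (k + (n + 1))) w) w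
    have h5 := norm_exp_sub_one_sub_id_le (x := ξ) (by linarith)
    have h6 := norm_sub_norm_le ξ (roomLimit (fun k => m (k + (n + 1))) w)
    rw [norm_sub_rev ξ] at h6
    rw [hexp, add_sub_cancel_left] at h5
    have h7 := (neg_le_abs ξ.re).trans (abs_re_le_norm ξ)
    have h8 : ‖ξ‖ ^ 2 ≤ 1 / 64 * ‖ξ‖ := by nlinarith [norm_nonneg ξ]
    rw [div_le_iff₀ (by positivity)]
    have h9 : ‖ξ‖ ≤ 2 * ‖w‖ := by linarith [norm_nonneg w]
    have h10 : m n * -ξ.re ≤ m n * (2 * ‖w‖) := by gcongr; linarith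
    linarith
  · have h1 := volume_le_volume_preimage_log_one_add_roomLimit hmt hE hEb
    rw [hEdef, volume_Icc_reProdIm_Icc, ← ENNReal.ofReal_mul
      (by rw [← sub_div]; apply div_nonneg _ hM.le; linarith)] at h1
    have h2 : 4 * ENNReal.ofReal (1 / (512 * m n)) ≤ ENNReal.ofReal
        ((-(L + 6 * Real.log 2) / m n - -(L + 7 * Real.log 2) / m n)
          * (1 / 128 - -(1 / 128))) := by
      rw [← ENNReal.ofReal_ofNat, ← ENNReal.ofReal_mul (by norm_num)]
      refine ENNReal.ofReal_le_ofReal ?_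
      rw [← sub_div, div_mul_eq_mul_div, le_div_iff₀ hM]
      field_simp
      linarith
    exact (ENNReal.mul_le_mul_iff_right (by norm_num) (by norm_num)).1 (h2.trans h1)

lemma norm_roomMap_le {k : ℕ} (hk : k ≠ 0) (y : ℂ) :
    9 * (1 + ‖roomMap k y‖) ≤ (9 * (1 + ‖y‖)) ^ (2 * k) := by
  have h1 : ‖1 + y‖ ≤ 1 + ‖y‖ := (norm_add_le _ _).trans (by simp)
  have hT : 1 ≤ (1 + ‖y‖) ^ k := one_le_pow₀ (by linarith [norm_nonneg y])
  have h2 : ‖(1 + y) ^ k‖ ≤ (1 + ‖y‖) ^ k := by rw [norm_pow]; gcongr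
  have h3 : ‖(1 + y) ^ k - 1‖ ≤ (1 + ‖y‖) ^ k + 1 :=
    (norm_sub_le _ _).trans (by rw [norm_one]; linarith)
  have h4 : ‖roomMap k y‖ ≤ 4 * (1 + ‖y‖) ^ k * ((1 + ‖y‖) ^ k + 1) := by
    rw [roomMap, norm_mul, norm_mul, Complex.norm_ofNat]
    gcongr
  have h5 : (9 : ℝ) ≤ 9 ^ k := le_self_pow₀ (by norm_num) hk
  rw [mul_pow, pow_mul', pow_mul']
  set T := (1 + ‖y‖) ^ k
  have h6 : (9 : ℝ) ^ 2 * T ^ 2 ≤ (9 ^ k) ^ 2 * T ^ 2 := by gcongr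
  nlinarith

lemma norm_roomComp_le (n : ℕ) {m : ℕ → ℕ} (hm : ∀ k, 2 ≤ m k) (y : ℂ) :
    9 * (1 + ‖roomComp n m y‖) ≤ (9 * (1 + ‖y‖)) ^ ∏ k ∈ Finset.range n, 2 * m k := by
  induction n generalizing m with
  | zero => simp [roomComp]
  | succ n ih =>
    rw [Finset.prod_range_succ', pow_mul, roomComp]
    refine (norm_roomMap_le (by have := hm 0; omega) _).trans ?_
    gcongr
    exact ih fun k => hm _

lemma log_norm_roomLimit_le {m : ℕ → ℕ} (hm : ∀ k, 2 ≤ m k) {n : ℕ} {z : ℂ}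
    (hz : ‖z‖ / roomScale n m ≤ 1 / 8) : Real.log ‖roomLimit m z‖ ≤ 10 * roomScale n m := by
  rw [← norm_div_roomScale hm] at hz
  have h1 := (norm_roomLimit_le_and_mem_slitPlane (m := fun k => m (k + n)) (fun k => hm _) hz).1
  have h2 := norm_roomComp_le n hm (roomLimit (fun k => m (k + n)) (z / roomScale n m))
  rw [← roomLimit_eq_roomComp hm] at h2
  set N := ∏ k ∈ Finset.range n, 2 * m k with hN
  have hNs : (N : ℝ) ≤ roomScale n m := by
    rw [hN, roomScale]
    push_cast
    gcongr
    norm_num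
  have h3 : ‖roomLimit m z‖ ≤ (11 : ℝ) ^ N := by
    have : (9 * (1 + ‖roomLimit (fun k => m (k + n)) (z / roomScale n m)‖)) ^ N ≤ (11 : ℝ) ^ N := by
      gcongr
      linarith
    linarith [norm_nonneg (roomLimit m z)]
  rcases (norm_nonneg (roomLimit m z)).eq_or_lt with h0 | h0
  · rw [← h0, Real.log_zero]
    linarith [roomScale_pos hm n]
  have h4 := Real.log_le_log h0 h3
  rw [Real.log_pow] at h4
  have h5 := Real.log_le_sub_one_of_pos (by norm_num : (0 : ℝ) < 11)
  have h6 : (N : ℝ) * Real.log 11 ≤ roomScale n m * (11 - 1) :=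
    mul_le_mul hNs h5 (Real.log_nonneg (by norm_num)) (roomScale_pos hm n).le
  linarith

lemma log_norm_roomLimit_le_sq {m : ℕ → ℕ} (hm : ∀ k, 2 ≤ m k) {C : ℝ}
    (hC : ∀ k, (m k : ℝ) ≤ C * 8 ^ k) {z : ℂ} (hz : 1 ≤ ‖z‖) :
    Real.log ‖roomLimit m z‖ ≤ 2560 * C * ‖z‖ ^ 2 := by
  classical
  have hex := exists_div_roomScale_le hm ‖z‖
  have hspec := log_norm_roomLimit_le hm (Nat.find_spec hex)
  have hmin := fun k => Nat.find_min hex (m := k)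
  set n := Nat.find hex with hn
  have hn0 : n ≠ 0 := by
    intro h0
    have := Nat.find_spec hex
    rw [← hn, h0] at this
    simp only [roomScale, Finset.range_zero, Finset.prod_empty, div_one] at this
    linarith
  obtain ⟨j, hj⟩ := Nat.exists_eq_succ_of_ne_zero hn0
  have hjz := hmin j (by omega)
  have hpos := roomScale_pos hm j
  rw [div_le_iff₀ hpos, not_le] at hjz
  have hC0 : 0 ≤ C := by simpa using (Nat.cast_nonneg _).trans (hC 0)
  have hCj : (m j : ℝ) ≤ C * roomScale j m := by
    exact (hC j).trans (by gcongr; exact pow_le_roomScale hm j)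
  rw [hj, Nat.succ_eq_add_one, roomScale_succ] at hspec
  calc _ ≤ 10 * (roomScale j m * (4 * m j)) := hspec
    _ ≤ 10 * (roomScale j m * (4 * (C * roomScale j m))) := by gcongr
    _ = 40 * C * roomScale j m ^ 2 := by ring
    _ ≤ 40 * C * (8 * ‖z‖) ^ 2 := by gcongr; linarith
    _ = _ := by ring

lemma entireOrder_roomLimit_ne_top {m : ℕ → ℕ} (hm : ∀ k, 2 ≤ m k) {C : ℝ}
    (hC : ∀ k, (m k : ℝ) ≤ C * 8 ^ k) : entireOrder (roomLimit m) ≠ ⊤ := by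
  refine ne_top_of_le_ne_top (ENNReal.ofReal_ne_top (r := 3)) (limsup_le_of_le (h := ?_))
  have hev := tendsto_comap (f := fun z : ℂ => ‖z‖) (x := atTop)
  filter_upwards [hev.eventually_ge_atTop (2560 * C), hev.eventually_ge_atTop 2] with z h1 h2
  refine ENNReal.ofReal_le_ofReal ?_
  have hlog : 0 < Real.log ‖z‖ := Real.log_pos (by linarith)
  have h3 : logPlus ‖roomLimit m z‖ ≤ ‖z‖ ^ 3 := by
    refine max_le (by positivity) ((log_norm_roomLimit_le_sq hm hC (by linarith)).trans ?_)
    rw [pow_succ' _ 2]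
    gcongr
  rw [div_le_iff₀ hlog]
  refine max_le (by positivity) ?_
  rcases (le_max_left 0 (Real.log ‖roomLimit m z‖)).eq_or_lt with h0 | h0
  · rw [logPlus, ← h0, Real.log_zero]
    positivity
  · have := Real.log_le_log h0 h3
    rw [Real.log_pow] at this
    exact_mod_cast this

/-- A preimage under a nonconstant polynomial of a bounded set has finite cylindrical area outside
the unit disc. -/
lemma cylArea_preimage_polynomial_ne_top {p : Polynomial ℂ} {K : Set ℂ}
    (hK : Bornology.IsBounded K) (h0 : p.eval 0 ∉ K) :
    cylArea ((fun z => p.eval z) ⁻¹' K \ ball 0 1) ≠ ⊤ := by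
  by_cases hp : 0 < p.degree
  · obtain ⟨R, hR⟩ := hK.subset_closedBall 0
    have ht := p.tendsto_norm_atTop hp (tendsto_norm_cobounded_atTop (E := ℂ))
    obtain ⟨S, -, hS⟩ := hasBasis_cobounded_norm.eventually_iff.1 (ht.eventually_gt_atTop R)
    have hsub : (fun z => p.eval z) ⁻¹' K \ ball 0 1 ⊆ ball 0 S \ ball 0 1 := by
      refine fun z hz => ⟨?_, hz.2⟩
      by_contra h
      rw [mem_ball_zero_iff, not_lt] at h
      exact (hS h).not_ge (mem_closedBall_zero_iff.1 (hR hz.1))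
    refine ((lintegral_mono_set hsub).trans_lt ?_).ne
    calc ∫⁻ z in ball (0 : ℂ) S \ ball 0 1, ENNReal.ofReal (1 / ‖z‖ ^ 2)
        ≤ ∫⁻ _ in ball (0 : ℂ) S \ ball 0 1, 1 := by
          refine setLIntegral_mono' (measurableSet_ball.diff measurableSet_ball) fun z hz => ?_
          have h1 : 1 ≤ ‖z‖ := not_lt.1 fun h => hz.2 (mem_ball_zero_iff.2 h)
          rw [ENNReal.ofReal_le_one]
          exact div_le_one_of_le₀ (one_le_pow₀ h1) (by positivity)
      _ ≤ volume (ball (0 : ℂ) S) := by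
          rw [setLIntegral_one]
          exact measure_mono sdiff_subset
      _ < ⊤ := measure_ball_lt_top
  · rw [Polynomial.eq_C_of_degree_le_zero (not_lt.1 hp)] at h0 ⊢
    simp only [Polynomial.eval_C] at h0 ⊢
    rw [preimage_const_of_notMem h0]
    simp [cylArea]

open scoped Pointwise in
lemma cylArea_eq_top {m : ℕ → ℕ} (hm : ∀ k, 2 ≤ m k)
    (hlog : ∀ n, 128 * (Real.log (roomScale n m) + 5) ≤ m n)
    (hsum : ¬ Summable fun n => (1 : ℝ) / m n) :
    cylArea (roomLimit m ⁻¹' (closedBall 0 (1 / 2) \ ball 0 (1 / 100)) \ ball 0 1) = ⊤ := by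
  choose A hAm hAb hA hAv using fun n => exists_set_roomLimit hm n (hlog n)
  have hpos := roomScale_pos hm
  have hM : ∀ n, (0 : ℝ) < m n := fun n => by exact_mod_cast (by have := hm n; omega)
  set T : ℕ → Set ℂ := fun n => roomScale (n + 1) m • A n with hT
  have hTm : ∀ n, MeasurableSet (T n) := fun n => (hAm n).const_smul₀ _
  have hTn : ∀ n, ∀ z ∈ T n, roomScale n m ≤ ‖z‖ ∧ ‖z‖ ≤ roomScale (n + 1) m / 8 := by
    rintro n _ ⟨w, hw, rfl⟩
    have h1 := (hA n w hw).1
    have h2 := mem_ball_zero_iff.1 (hAb n hw)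
    simp only [norm_smul, Real.norm_of_nonneg (hpos (n + 1)).le]
    constructor
    · calc roomScale n m = roomScale (n + 1) m * (1 / (4 * m n)) := by
            rw [roomScale_succ]; have := (hM n).ne'; field_simp
        _ ≤ _ := by gcongr; exact (hpos _).le
    · nlinarith [hpos (n + 1)]
  have hmono : Monotone fun n => roomScale n m := monotone_nat_of_le_succ fun n => by
    rw [roomScale_succ]
    have : (2 : ℝ) ≤ m n := by exact_mod_cast hm n
    nlinarith [hpos n]
  have hdisj : Pairwise (Function.onFun Disjoint T) := by
    refine (pairwise_disjoint_on T).2 fun i j hij => Set.disjoint_left.2 fun z hi hj => ?_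
    have h1 := (hTn i z hi).2
    have h2 := (hTn j z hj).1
    have h3 : roomScale (i + 1) m ≤ roomScale j m := hmono hij
    linarith [hpos (i + 1)]
  have hsub : ⋃ n, T n ⊆ roomLimit m ⁻¹' (closedBall 0 (1 / 2) \ ball 0 (1 / 100)) \ ball 0 1 := by
    refine iUnion_subset fun n z hz => ⟨?_, ?_⟩
    · obtain ⟨w, hw, rfl⟩ := hz
      obtain ⟨-, h1, h2⟩ := hA n w hw
      simp only [mem_preimage, Set.mem_sdiff, mem_closedBall_zero_iff, mem_ball_zero_iff, not_lt,
        real_smul]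
      exact ⟨h2, h1⟩
    · rw [mem_ball_zero_iff, not_lt]
      exact (one_le_roomScale hm n).trans (hTn n z hz).1
  have hint : ∀ n, ENNReal.ofReal (1 / 8 * (1 / m n)) ≤
      ∫⁻ z in T n, ENNReal.ofReal (1 / ‖z‖ ^ 2) := by
    intro n
    set Λ := roomScale (n + 1) m
    have hΛ : 0 < Λ := hpos (n + 1)
    calc ENNReal.ofReal (1 / 8 * (1 / m n))
        = ENNReal.ofReal (1 / (Λ / 8) ^ 2) * (ENNReal.ofReal (Λ ^ 2)
            * ENNReal.ofReal (1 / (512 * m n))) := by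
          rw [← ENNReal.ofReal_mul (by positivity), ← ENNReal.ofReal_mul (by positivity)]
          congr 1
          field_simp
          norm_num
      _ ≤ ENNReal.ofReal (1 / (Λ / 8) ^ 2) * (ENNReal.ofReal (Λ ^ 2) * volume (A n)) := by
          gcongr
          exact hAv n
      _ = ENNReal.ofReal (1 / (Λ / 8) ^ 2) * volume (T n) := by
          rw [hT, Measure.addHaar_smul, finrank_real_complex, abs_of_nonneg (by positivity)]
      _ = ∫⁻ _ in T n, ENNReal.ofReal (1 / (Λ / 8) ^ 2) := (setLIntegral_const _ _).symm
      _ ≤ _ := by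
          refine setLIntegral_mono' (hTm n) fun z hz => ENNReal.ofReal_le_ofReal ?_
          obtain ⟨h1, h2⟩ := hTn n z hz
          have := (hpos n).trans_le h1
          gcongr
  refine top_unique ?_
  calc ⊤ = ∑' n, ENNReal.ofReal (1 / 8 * (1 / m n)) := by
        by_contra h
        have h1 := ENNReal.summable_toReal (Ne.symm h)
        refine hsum ((summable_mul_left_iff (by norm_num : (1 / 8 : ℝ) ≠ 0)).1 ?_)
        refine h1.congr fun n => ENNReal.toReal_ofReal ?_
        positivity
    _ ≤ ∑' n, ∫⁻ z in T n, ENNReal.ofReal (1 / ‖z‖ ^ 2) := ENNReal.tsum_le_tsum hint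
    _ = ∫⁻ z in ⋃ n, T n, ENNReal.ofReal (1 / ‖z‖ ^ 2) := (lintegral_iUnion hTm hdisj _).symm
    _ ≤ _ := lintegral_mono_set hsub

/-- A sequence of degrees growing barely slowly enough for its reciprocals to have infinite sum. -/
def roomDegree (k : ℕ) : ℕ := 4096 * ((k + 1) * (1 + Nat.log 2 (k + 1)))

lemma two_le_roomDegree (k : ℕ) : 2 ≤ roomDegree k := by
  have : 0 < (k + 1) * (1 + Nat.log 2 (k + 1)) := by positivity
  rw [roomDegree]
  omega

lemma roomDegree_le (k : ℕ) : (roomDegree k : ℝ) ≤ 4096 * 8 ^ k := by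
  have h1 : Nat.log 2 (k + 1) ≤ k := Nat.lt_succ_iff.1 (Nat.log_lt_self 2 (by omega))
  have h2 : k + 1 ≤ 2 ^ k := Nat.lt_two_pow_self
  have h3 : roomDegree k ≤ 4096 * 8 ^ k := by
    rw [roomDegree]
    gcongr
    calc (k + 1) * (1 + Nat.log 2 (k + 1)) ≤ 2 ^ k * 2 ^ k := by gcongr; omega
      _ = 4 ^ k := by rw [← mul_pow]; norm_num
      _ ≤ 8 ^ k := by gcongr; norm_num
  exact_mod_cast h3

lemma log_roomScale_roomDegree_le (n : ℕ) :
    Real.log (roomScale n roomDegree) ≤ 12 * (n * (1 + Nat.log 2 (n + 1) : ℕ)) := by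
  induction n with
  | zero => simp [roomScale]
  | succ n ih =>
    have hpos : (0 : ℝ) < roomDegree n := by
      exact_mod_cast (by have := two_le_roomDegree n; omega : 0 < roomDegree n)
    rw [roomScale_succ, Real.log_mul (roomScale_pos two_le_roomDegree n).ne' (by positivity)]
    have hmono : Nat.log 2 (n + 1) ≤ Nat.log 2 (n + 1 + 1) := Nat.log_mono_right (by omega)
    have h1 : Nat.log 2 (n + 1) ≤ n := Nat.lt_succ_iff.1 (Nat.log_lt_self 2 (by omega))
    have h2 : n + 1 ≤ 2 ^ (1 + Nat.log 2 (n + 1)) := by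
      rw [add_comm 1]; exact (Nat.lt_pow_succ_log_self (by norm_num) _).le
    set l := 1 + Nat.log 2 (n + 1) with hl
    have h3 : 4 * roomDegree n ≤ 2 ^ (14 + 2 * l) := by
      rw [roomDegree, ← hl]
      calc 4 * (4096 * ((n + 1) * l)) = 2 ^ 14 * ((n + 1) * l) := by ring
        _ ≤ 2 ^ 14 * (2 ^ l * 2 ^ l) := by gcongr; omega
        _ = _ := by ring
    have h4 : Real.log (4 * roomDegree n) ≤ (14 + 2 * l) * Real.log 2 := by
      have := Real.log_le_log (by positivity)
        (by exact_mod_cast h3 : (4 * roomDegree n : ℝ) ≤ 2 ^ (14 + 2 * l))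
      rw [Real.log_pow] at this
      exact_mod_cast this
    have h5 : (1 : ℝ) ≤ l := by exact_mod_cast (by omega : 1 ≤ l)
    have h6 : (l : ℝ) ≤ (1 + Nat.log 2 (n + 1 + 1) : ℕ) := by exact_mod_cast (by omega)
    have h7 := Real.log_two_lt_d9
    have h8 : Real.log (4 * roomDegree n) ≤ 12 * l := by nlinarith
    calc _ ≤ 12 * (n * (l : ℝ)) + 12 * l := add_le_add ih h8
      _ = 12 * ((n + 1) * (l : ℝ)) := by ring
      _ ≤ 12 * ((n + 1) * ((1 + Nat.log 2 (n + 1 + 1) : ℕ) : ℝ)) := by gcongr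
      _ = _ := by push_cast; ring

lemma log_roomScale_add_le_roomDegree (n : ℕ) :
    128 * (Real.log (roomScale n roomDegree) + 5) ≤ roomDegree n := by
  have h := log_roomScale_roomDegree_le n
  have h1 : (1 : ℝ) ≤ (1 + Nat.log 2 (n + 1) : ℕ) := by exact_mod_cast (by omega)
  rw [roomDegree]
  set l := 1 + Nat.log 2 (n + 1)
  push_cast
  have hn : (0 : ℝ) ≤ n := by positivity
  nlinarith [mul_nonneg hn (by linarith : (0 : ℝ) ≤ l)]

lemma not_summable_one_div_roomDegree : ¬ Summable fun n => (1 : ℝ) / roomDegree n := by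
  intro h
  have h1 : Summable fun n : ℕ => (1 : ℝ) / (n * (1 + Nat.log 2 n : ℕ)) := by
    rw [← summable_nat_add_iff 1]
    refine (h.mul_left 4096).congr fun n => ?_
    rw [roomDegree]
    push_cast
    field_simp
  rw [← summable_condensed_iff_of_nonneg (fun n => by positivity)] at h1
  · refine Real.not_summable_one_div_natCast ((summable_nat_add_iff 1).1 (h1.congr fun n => ?_))
    rw [Nat.log_pow (by norm_num)]
    push_cast
    field_simp
    ring
  · intro i j hi hij
    apply one_div_le_one_div_of_le (by positivity)
    gcongr

theorem counterexample_area_property_near_infinity :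
    ∃ f : ℂ → ℂ, TranscendentalEntire f ∧ entireOrder f ≠ ⊤ ∧
      Bornology.IsBounded (singularSet f) ∧
      ∃ (z₀ : ℂ) (K : Set ℂ),
        z₀ ∈ (singularSet f)ᶜ ∧
        ¬ Bornology.IsBounded (connectedComponentIn (singularSet f)ᶜ z₀) ∧
        IsCompact K ∧
        K ⊆ connectedComponentIn (singularSet f)ᶜ z₀ ∧
        cylArea (f ⁻¹' K \ Metric.ball (0 : ℂ) 1) = ⊤ := by
  have hm := two_le_roomDegree
  have hS := singularSet_roomLimit_subset hm
  have htop := cylArea_eq_top hm log_roomScale_add_le_roomDegree not_summable_one_div_roomDegree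
  have hfin : ({0, -1} : Set ℂ).Finite := toFinite _
  have hconn : IsPreconnected ({0, -1}ᶜ : Set ℂ) :=
    (hfin.countable.isPathConnected_compl_of_one_lt_rank
      (by rw [rank_real_complex]; norm_num)).isConnected.isPreconnected
  have hone : (1 : ℂ) ∈ ({0, -1}ᶜ : Set ℂ) := by
    simp only [mem_compl_iff, mem_insert_iff, mem_singleton_iff]
    norm_num
  have hcomp := hconn.subset_connectedComponentIn hone (compl_subset_compl.2 hS)
  refine ⟨roomLimit roomDegree, ⟨differentiable_roomLimit hm, ?_⟩,
    entireOrder_roomLimit_ne_top hm roomDegree_le, hfin.isBounded.subset hS, 1,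
    closedBall 0 (1 / 2) \ ball 0 (1 / 100), compl_subset_compl.2 hS hone, fun hb => ?_,
    (isCompact_closedBall _ _).diff isOpen_ball, subset_trans ?_ hcomp, htop⟩
  · rintro ⟨p, hp⟩
    rw [funext hp] at htop
    refine cylArea_preimage_polynomial_ne_top (isBounded_closedBall.subset sdiff_subset) ?_ htop
    rw [← hp, roomLimit_zero]
    simp
  · have := (hb.subset hcomp).union hfin.isBounded
    rw [compl_union_self] at this
    exact NormedSpace.unbounded_univ ℝ ℂ this
  · rintro z ⟨h1, h2⟩
    simp only [mem_compl_iff, mem_insert_iff, mem_singleton_iff, not_or]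
    rw [mem_closedBall_zero_iff] at h1
    rw [mem_ball_zero_iff, not_lt] at h2
    constructor <;> rintro rfl
    · norm_num at h2
    · norm_num at h1
end

section
/- Let f, g be entire functions and φ, ψ : ℂ → ℂ homeomorphisms with ψ ∘ f = g ∘ φ. Suppose there are constants C ≥ 1, K ≥ 1 and R > 0 such that |z|/C ≤ |φ(z)| ≤ C|z| for all |z| ≥ R, and |w|^{1/K}/C ≤ |ψ(w)| ≤ C|w|^K for all |w| ≥ R. Then ρ(f) = ρ(g). -/
open Complex Set Filter Topology Metric MeasureTheory
open scoped ENNReal Real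

theorem logPlus_nonneg (x : ℝ) : 0 ≤ logPlus x := le_max_left _ _

theorem logPlus_le_logPlus {x y : ℝ} (hx : 0 ≤ x) (hxy : x ≤ y) : logPlus x ≤ logPlus y := by
  rcases hx.eq_or_lt with rfl | hx
  · simp [logPlus]
  · exact max_le_max le_rfl (Real.log_le_log hx hxy)

theorem logPlus_affine_le {A B x : ℝ} (hA : 0 ≤ A) (hB : 1 ≤ B) (hx : 0 ≤ x) :
    logPlus (A + B * x) ≤ Real.log (A + B) + logPlus x := by
  have hAB : 0 ≤ Real.log (A + B) := Real.log_nonneg (by linarith)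
  have hle : A + B * x ≤ (A + B) * max 1 x := by
    nlinarith [le_max_left 1 x, le_max_right 1 x,
      mul_le_mul_of_nonneg_left (le_max_left 1 x) hA,
      mul_le_mul_of_nonneg_left (le_max_right 1 x) (zero_le_one.trans hB)]
  have hmax : Real.log (max 1 x) ≤ logPlus x := by
    rcases le_total 1 x with h | h
    · rw [max_eq_right h]
      exact le_max_right _ _
    · rw [max_eq_left h, Real.log_one]
      exact logPlus_nonneg x
  refine max_le (add_nonneg hAB (logPlus_nonneg x)) ?_
  rcases (show 0 ≤ A + B * x by positivity).eq_or_lt with h | h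
  · rw [← h, Real.log_zero]
    exact add_nonneg hAB (logPlus_nonneg x)
  · calc Real.log (A + B * x) ≤ Real.log ((A + B) * max 1 x) := Real.log_le_log h hle
      _ = Real.log (A + B) + Real.log (max 1 x) :=
        Real.log_mul (by linarith) (by positivity)
      _ ≤ _ := by linarith

theorem map_homeomorph_comap_norm_atTop (φ : ℂ ≃ₜ ℂ) :
    Filter.map φ (Filter.comap (fun z : ℂ => ‖z‖) atTop) =
      Filter.comap (fun z : ℂ => ‖z‖) atTop := by
  rw [comap_norm_atTop, cobounded_eq_cocompact]
  exact φ.map_cocompact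

/-- If `log⁺ |g ∘ φ|` is at most an affine function of `log⁺ |f|` and `φ` shrinks moduli by at most
a bounded factor near infinity, then the order of `g` is at most that of `f`. -/
theorem entireOrder_le_of_logPlus_le {f g : ℂ → ℂ} (φ : ℂ ≃ₜ ℂ) {A B c : ℝ}
    (hA : 0 ≤ A) (hB : 1 ≤ B)
    (hfg : ∀ z, logPlus ‖g (φ z)‖ ≤ A + B * logPlus ‖f z‖)
    (hφ : ∀ᶠ z in Filter.comap (fun z : ℂ => ‖z‖) atTop,
      Real.log ‖z‖ - c ≤ Real.log ‖φ z‖) :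
    entireOrder g ≤ entireOrder f := by
  refine le_of_forall_gt_imp_ge_of_dense fun r hr => ?_
  obtain ⟨t, hft, htr⟩ := exists_between hr
  rcases eq_or_ne r ⊤ with rfl | hr'
  · exact le_top
  lift r to NNReal using hr'
  lift t to NNReal using htr.ne_top
  have htr' : (t : ℝ) < r := by exact_mod_cast htr
  have hev := Filter.eventually_lt_of_limsup_lt hft
  have hlog : Tendsto (fun z : ℂ => Real.log ‖z‖)
      (Filter.comap (fun z : ℂ => ‖z‖) atTop) atTop :=
    Real.tendsto_log_atTop.comp tendsto_comap
  refine Filter.limsup_le_of_le (by isBoundedDefault) ?_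
  rw [← map_homeomorph_comap_norm_atTop φ, Filter.eventually_map]
  filter_upwards [hev, hφ, hlog.eventually_gt_atTop 0, hlog.eventually_gt_atTop c,
    hlog.eventually_ge_atTop ((Real.log (A + B) + r * c) / (r - t))] with z hz hzφ h0 hc hlarge
  have hft : logPlus (logPlus ‖f z‖) < t * Real.log ‖z‖ := by
    rw [← div_lt_iff₀ h0]
    refine (ENNReal.ofReal_lt_ofReal_iff_of_nonneg
      (div_nonneg (logPlus_nonneg _) h0.le) (q := (t : ℝ))).1 ?_
    rwa [ENNReal.ofReal_coe_nnreal]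
  have hgf : logPlus (logPlus ‖g (φ z)‖) ≤ Real.log (A + B) + logPlus (logPlus ‖f z‖) :=
    (logPlus_le_logPlus (logPlus_nonneg _) (hfg z)).trans
      (logPlus_affine_le hA hB (logPlus_nonneg _))
  rw [div_le_iff₀ (sub_pos.2 htr')] at hlarge
  have hmul := mul_le_mul_of_nonneg_left hzφ r.coe_nonneg
  rw [← ENNReal.ofReal_coe_nnreal]
  refine ENNReal.ofReal_le_ofReal ((div_le_iff₀ (by linarith)).2 ?_)
  nlinarith

theorem exists_logPlus_apply_le {ψ : ℂ → ℂ} (hcont : Continuous ψ) {C K R : ℝ}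
    (hC : 1 ≤ C) (hK : 1 ≤ K) (hR : 0 < R)
    (hψ : ∀ w : ℂ, R ≤ ‖w‖ → ‖ψ w‖ ≤ C * ‖w‖ ^ K) :
    ∃ A, 0 ≤ A ∧ ∀ w, logPlus ‖ψ w‖ ≤ A + K * logPlus ‖w‖ := by
  obtain ⟨M, hM⟩ := (isCompact_closedBall (0 : ℂ) R).exists_bound_of_continuousOn
    hcont.continuousOn
  have hlogC : 0 ≤ Real.log C := Real.log_nonneg hC
  refine ⟨Real.log C + logPlus M, add_nonneg hlogC (logPlus_nonneg M), fun w => ?_⟩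
  have hw0 : 0 ≤ K * logPlus ‖w‖ := mul_nonneg (by linarith) (logPlus_nonneg _)
  have hM0 := logPlus_nonneg M
  rcases le_total R ‖w‖ with h | h
  · have hw : 0 < ‖w‖ := hR.trans_le h
    refine max_le (by linarith) ?_
    rcases (norm_nonneg (ψ w)).eq_or_lt with h' | h'
    · rw [← h', Real.log_zero]
      linarith
    · have hle := Real.log_le_log h' (hψ w h)
      rw [Real.log_mul (by linarith) (by positivity), Real.log_rpow hw] at hle
      have : K * Real.log ‖w‖ ≤ K * logPlus ‖w‖ :=
        mul_le_mul_of_nonneg_left (le_max_right _ _) (by linarith)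
      linarith
  · have := logPlus_le_logPlus (norm_nonneg (ψ w)) (hM w (by simpa using h))
    linarith

theorem exists_logPlus_le_apply {ψ : ℂ → ℂ} {C K R : ℝ}
    (hC : 1 ≤ C) (hK : 1 ≤ K) (hR : 0 < R)
    (hψ : ∀ w : ℂ, R ≤ ‖w‖ → ‖w‖ ^ (1 / K) / C ≤ ‖ψ w‖) :
    ∃ A, 0 ≤ A ∧ ∀ w, logPlus ‖w‖ ≤ A + K * logPlus ‖ψ w‖ := by
  have hK0 : 0 < K := by linarith
  have hlogC : 0 ≤ K * Real.log C := mul_nonneg hK0.le (Real.log_nonneg hC)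
  refine ⟨K * Real.log C + logPlus R, add_nonneg hlogC (logPlus_nonneg R), fun w => ?_⟩
  have hw0 : 0 ≤ K * logPlus ‖ψ w‖ := mul_nonneg hK0.le (logPlus_nonneg _)
  have hR0 := logPlus_nonneg R
  rcases le_total R ‖w‖ with h | h
  · have hw : 0 < ‖w‖ := hR.trans_le h
    refine max_le (by linarith) ?_
    have hle := Real.log_le_log (by positivity) (hψ w h)
    rw [Real.log_div (by positivity) (by linarith), Real.log_rpow hw] at hle
    have hle' := hle.trans (le_max_right 0 (Real.log ‖ψ w‖))
    have hmul := mul_le_mul_of_nonneg_left hle' hK0.le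
    rw [mul_sub, ← mul_assoc, mul_one_div_cancel hK0.ne', one_mul] at hmul
    change _ ≤ K * logPlus ‖ψ w‖ at hmul
    linarith
  · have := logPlus_le_logPlus (norm_nonneg w) h
    linarith

theorem order_invariant_under_lipschitz_equivalence (f g : ℂ → ℂ)
    (hf : Differentiable ℂ f) (hg : Differentiable ℂ g)
    (φ ψ : ℂ ≃ₜ ℂ) (hequiv : ∀ z : ℂ, ψ (f z) = g (φ z))
    (C K R : ℝ) (hC : 1 ≤ C) (hK : 1 ≤ K) (hR : 0 < R)
    (hφ : ∀ z : ℂ, R ≤ ‖z‖ → ‖z‖ / C ≤ ‖φ z‖ ∧ ‖φ z‖ ≤ C * ‖z‖)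
    (hψ : ∀ w : ℂ, R ≤ ‖w‖ → ‖w‖ ^ (1 / K) / C ≤ ‖ψ w‖ ∧ ‖ψ w‖ ≤ C * ‖w‖ ^ K) :
    entireOrder f = entireOrder g := by
  have hlarge : ∀ᶠ z in Filter.comap (fun z : ℂ => ‖z‖) atTop, R ≤ ‖z‖ :=
    tendsto_comap.eventually (eventually_ge_atTop R)
  obtain ⟨A, hA, hψA⟩ := exists_logPlus_apply_le ψ.continuous hC hK hR fun w hw => (hψ w hw).2
  obtain ⟨A', hA', hψA'⟩ := exists_logPlus_le_apply hC hK hR fun w hw => (hψ w hw).1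
  apply le_antisymm
  · refine entireOrder_le_of_logPlus_le φ.symm (c := Real.log C) hA' hK (fun z => ?_) ?_
    · simpa [hequiv] using hψA' (f (φ.symm z))
    · rw [← map_homeomorph_comap_norm_atTop φ, Filter.eventually_map]
      filter_upwards [hlarge] with z hz
      have hz0 : 0 < ‖z‖ := hR.trans_le hz
      have hφ0 : 0 < ‖φ z‖ := lt_of_lt_of_le (by positivity) (hφ z hz).1
      have hle := Real.log_le_log hφ0 (hφ z hz).2
      rw [Real.log_mul (by linarith) hz0.ne'] at hle
      rw [φ.symm_apply_apply]
      linarith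
  · refine entireOrder_le_of_logPlus_le φ (c := Real.log C) hA hK (fun z => ?_) ?_
    · rw [← hequiv]
      exact hψA (f z)
    · filter_upwards [hlarge] with z hz
      have hz0 : 0 < ‖z‖ := hR.trans_le hz
      rw [← Real.log_div hz0.ne' (by linarith)]
      exact Real.log_le_log (by positivity) (hφ z hz).1
end
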